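/- arXiv:2210.11148 — 2 statements merged into one kernel-verified Lean document; each statement's English description precedes it below -/
import Mathlib

section
/- Let G be a Helly group, i.e. a group acting geometrically on a Helly graph. Then every abelian subgroup of G is finitely generated. -/
open Set Filter Topology

namespace CoarseHelly

section InjectiveHull

variable {X : Type*} [PseudoMetricSpace X]

/-- `f` belongs to the set of which the minimal elements form the injective hull of `X`. -/
def IsRadius (f : X → ℝ) : Prop :=
  ∀ x y, dist x y ≤ f x + f y

/-- A coarse form of hyperconvexity: balls of radii `f` that could intersect pairwise have a
common point after enlarging the radii by `1`. -/
def CoarselyInjective (X : Type*) [PseudoMetricSpace X] : Prop :=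
  ∀ f : X → ℝ, IsRadius f → ∃ p, ∀ z, dist p z ≤ f z + 1

/-- The smallest function `g` with `dist x z ≤ g x + f z` for all `x` and `z`. -/
noncomputable def conj (f : X → ℝ) (x : X) : ℝ :=
  ⨆ z, (dist x z - f z)

/-- One step of the iteration retracting the functions `IsRadius` onto the injective hull. -/
noncomputable def retractStep (f : X → ℝ) (x : X) : ℝ :=
  (f x + conj f x) / 2

theorem IsRadius.bddAbove {f : X → ℝ} (hf : IsRadius f) (x : X) :
    BddAbove (range fun z ↦ dist x z - f z) := by
  refine ⟨f x, ?_⟩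
  rintro _ ⟨z, rfl⟩
  have := hf x z
  simp only
  linarith

theorem IsRadius.dist_sub_le_conj {f : X → ℝ} (hf : IsRadius f) (x z : X) :
    dist x z - f z ≤ conj f x :=
  le_ciSup (hf.bddAbove x) z

theorem conj_le {f : X → ℝ} {x : X} {c : ℝ} (h : ∀ z, dist x z - f z ≤ c) : conj f x ≤ c :=
  haveI : Nonempty X := ⟨x⟩
  ciSup_le h

theorem IsRadius.conj_le_self {f : X → ℝ} (hf : IsRadius f) (x : X) : conj f x ≤ f x :=
  conj_le fun z ↦ by linarith [hf x z]

theorem IsRadius.conj_le_conj_add {f g : X → ℝ} (hf : IsRadius f) {c : ℝ}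
    (h : ∀ z, f z ≤ g z + c) (x : X) : conj g x ≤ conj f x + c :=
  conj_le fun z ↦ by linarith [hf.dist_sub_le_conj x z, h z]

theorem IsRadius.retractStep_le {f : X → ℝ} (hf : IsRadius f) (x : X) : retractStep f x ≤ f x := by
  unfold retractStep
  linarith [hf.conj_le_self x]

theorem IsRadius.isRadius_retractStep {f : X → ℝ} (hf : IsRadius f) : IsRadius (retractStep f) := by
  intro x y
  unfold retractStep
  have h₁ := hf.dist_sub_le_conj x y
  have h₂ := hf.dist_sub_le_conj y x
  rw [dist_comm] at h₂
  linarith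

theorem IsRadius.retractStep_sub_conj_le {f : X → ℝ} (hf : IsRadius f) (x : X) :
    retractStep f x - conj (retractStep f) x ≤ (f x - conj f x) / 2 := by
  have := hf.isRadius_retractStep.conj_le_conj_add (g := f) (c := 0)
    (fun z ↦ by simpa using hf.retractStep_le z) x
  simp only [retractStep] at this ⊢
  linarith

theorem abs_retractStep_sub_le {f g : X → ℝ} (hf : IsRadius f) (hg : IsRadius g) {c : ℝ}
    (h : ∀ z, |f z - g z| ≤ c) (x : X) : |retractStep f x - retractStep g x| ≤ c := by
  have h₁ := hf.conj_le_conj_add (g := g) (c := c) (fun z ↦ by linarith [(abs_le.1 (h z)).2]) x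
  have h₂ := hg.conj_le_conj_add (g := f) (c := c) (fun z ↦ by linarith [(abs_le.1 (h z)).1]) x
  have h₃ := abs_le.1 (h x)
  rw [abs_le]
  constructor <;> simp only [retractStep] <;> linarith [h₃.1, h₃.2]

theorem IsRadius.isRadius_iterate {f : X → ℝ} (hf : IsRadius f) (n : ℕ) :
    IsRadius (retractStep^[n] f) := by
  induction n with
  | zero => exact hf
  | succ n ih => rw [Function.iterate_succ_apply']; exact ih.isRadius_retractStep

theorem IsRadius.iterate_retractStep_le {f : X → ℝ} (hf : IsRadius f) (n : ℕ) (x : X) :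
    retractStep^[n] f x ≤ f x := by
  induction n with
  | zero => exact le_rfl
  | succ n ih =>
    rw [Function.iterate_succ_apply']
    exact ((hf.isRadius_iterate n).retractStep_le x).trans ih

theorem IsRadius.iterate_retractStep_sub_conj_le {f : X → ℝ} (hf : IsRadius f) (n : ℕ) (x : X) :
    retractStep^[n] f x - conj (retractStep^[n] f) x
      ≤ (f x - conj f x) / 2 ^ n := by
  induction n with
  | zero => simp
  | succ n ih =>
    rw [Function.iterate_succ_apply']
    refine ((hf.isRadius_iterate n).retractStep_sub_conj_le x).trans ?_
    rw [pow_succ, ← div_div]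
    gcongr

theorem abs_iterate_retractStep_sub_le {f g : X → ℝ} (hf : IsRadius f) (hg : IsRadius g) {c : ℝ}
    (h : ∀ z, |f z - g z| ≤ c) (n : ℕ) (x : X) :
    |retractStep^[n] f x - retractStep^[n] g x| ≤ c := by
  induction n generalizing x with
  | zero => exact h x
  | succ n ih =>
    rw [Function.iterate_succ_apply', Function.iterate_succ_apply']
    exact abs_retractStep_sub_le (hf.isRadius_iterate n) (hg.isRadius_iterate n) ih x

/-- A function close to the distance function of a point is represented, after boundedly many
retraction steps, by a point up to an additive error. -/
theorem CoarselyInjective.exists_iterate_approx (hX : CoarselyInjective X) (R : ℝ) :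
    ∃ n : ℕ, ∀ f : X → ℝ, IsRadius f → ∀ p, (∀ z, f z ≤ dist p z + R) →
      ∃ y, ∀ z, |dist y z - retractStep^[n] f z| ≤ 2 := by
  obtain ⟨n, hn⟩ := pow_unbounded_of_one_lt (2 * R) (one_lt_two (α := ℝ))
  refine ⟨n, fun f hf p hp ↦ ?_⟩
  obtain ⟨y, hy⟩ := hX _ (hf.isRadius_iterate n)
  refine ⟨y, fun z ↦ ?_⟩
  have h₁ : f z - conj f z ≤ 2 * R := by
    have h₂ := hf.dist_sub_le_conj z p
    have h₃ := hp p
    have h₄ := hp z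
    rw [dist_self] at h₃
    rw [dist_comm] at h₂
    linarith
  have h₅ : (f z - conj f z) / 2 ^ n ≤ 1 := by
    rw [div_le_one (by positivity)]
    linarith
  have h₆ := hf.iterate_retractStep_sub_conj_le n z
  have h₇ : conj (retractStep^[n] f) z ≤ dist y z + 1 := conj_le fun w ↦ by
    have := hy w
    have := dist_triangle z y w
    rw [dist_comm z y] at this
    linarith
  rw [abs_le]
  constructor <;> linarith [hy z]

variable {A : Type*} [Group A] [MulAction A X] [IsIsometricSMul A X]

theorem conj_smul (a : A) (f : X → ℝ) (x : X) : conj f (a • x) = conj (fun z ↦ f (a • z)) x := by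
  unfold conj
  rw [← (MulAction.toPerm a : Equiv.Perm X).iSup_comp]
  simp [dist_smul]

theorem iterate_retractStep_smul (a : A) (f : X → ℝ) (n : ℕ) (x : X) :
    retractStep^[n] f (a • x) = retractStep^[n] (fun z ↦ f (a • z)) x := by
  induction n generalizing x with
  | zero => rfl
  | succ n ih =>
    rw [Function.iterate_succ_apply', Function.iterate_succ_apply', retractStep, retractStep,
      conj_smul, ih, funext ih]

theorem IsRadius.comp_smul {f : X → ℝ} (hf : IsRadius f) (a : A) :
    IsRadius fun z ↦ f (a • z) := fun x y ↦ by
  simpa [dist_smul] using hf (a • x) (a • y)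

theorem abs_dist_smul_sub_le (a : A) (x z : X) : |dist x (a • z) - dist x z| ≤ dist x (a • x) := by
  rw [← dist_smul a x z]
  exact abs_dist_sub_le x (a • x) (a • z)

end InjectiveHull

section TranslationLength

variable {X : Type*} [PseudoMetricSpace X] {A : Type*}

theorem subadditive_dist_pow_smul [Group A] [MulAction A X] [IsIsometricSMul A X] (x : X) (a : A) :
    Subadditive fun n : ℕ ↦ dist x (a ^ n • x) := fun m n ↦ by
  have := dist_triangle x (a ^ m • x) (a ^ (m + n) • x)
  rwa [pow_add, mul_smul, dist_smul, ← mul_smul, ← pow_add] at this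

/-- The stable translation length of `a`, measured along the orbit of `x`. -/
noncomputable def translationLength [Group A] [MulAction A X] [IsIsometricSMul A X]
    (x : X) (a : A) : ℝ :=
  (subadditive_dist_pow_smul x a).lim

section Group

variable [Group A] [MulAction A X] [IsIsometricSMul A X] (x : X)

theorem tendsto_translationLength (a : A) :
    Tendsto (fun n : ℕ ↦ dist x (a ^ n • x) / n) atTop (𝓝 (translationLength x a)) := by
  refine (subadditive_dist_pow_smul x a).tendsto_lim ⟨0, ?_⟩
  rintro _ ⟨n, rfl⟩
  positivity

theorem translationLength_nonneg (a : A) : 0 ≤ translationLength x a :=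
  ge_of_tendsto' (tendsto_translationLength x a) fun n ↦ by positivity

theorem translationLength_inv (a : A) : translationLength x a⁻¹ = translationLength x a := by
  refine tendsto_nhds_unique (tendsto_translationLength x a⁻¹) ?_
  convert tendsto_translationLength x a using 3 with n
  rw [← dist_smul (a ^ n), ← mul_smul, dist_comm, inv_pow]
  simp

theorem translationLength_pow (a : A) (m : ℕ) :
    translationLength x (a ^ m) = m * translationLength x a := by
  rcases Nat.eq_zero_or_pos m with rfl | hm
  · refine tendsto_nhds_unique (tendsto_translationLength x (a ^ 0)) ?_
    simp
  have hm' : Tendsto (fun n : ℕ ↦ m * n) atTop atTop :=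
    tendsto_id.const_mul_atTop' hm
  refine tendsto_nhds_unique (tendsto_translationLength x (a ^ m)) ?_
  convert ((tendsto_translationLength x a).comp hm').const_mul (m : ℝ) using 2 with n
  have : (m : ℝ) ≠ 0 := by positivity
  rw [Function.comp_apply, ← pow_mul]
  push_cast
  rw [mul_div_assoc', mul_div_mul_left _ _ this]

theorem dist_pow_smul_le (a : A) (y : X) (n : ℕ) : dist y (a ^ n • y) ≤ n * dist y (a • y) := by
  induction n with
  | zero => simp
  | succ n ih =>
    have := subadditive_dist_pow_smul y a n 1
    simp only [pow_one] at this
    push_cast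
    linarith

theorem translationLength_le_dist (a : A) (y : X) : translationLength x a ≤ dist y (a • y) := by
  have h : Tendsto (fun n : ℕ ↦ 2 * dist x y / n + dist y (a • y)) atTop
      (𝓝 (0 + dist y (a • y))) :=
    (tendsto_const_div_atTop_nhds_zero_nat _).add_const _
  rw [zero_add] at h
  refine le_of_tendsto_of_tendsto (tendsto_translationLength x a) h ?_
  filter_upwards [eventually_gt_atTop 0] with n hn
  have hn' : (0 : ℝ) < n := by exact_mod_cast hn
  rw [div_add' _ _ _ hn'.ne']
  gcongr
  have h₁ := dist_triangle4 x y (a ^ n • y) (a ^ n • x)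
  rw [dist_smul, dist_comm y x] at h₁
  linarith [dist_pow_smul_le a y n]

theorem translationLength_eq (x y : X) (a : A) :
    translationLength x a = translationLength y a := by
  have hle (x y : X) : translationLength x a ≤ translationLength y a := by
    refine ge_of_tendsto (tendsto_translationLength y a) ?_
    filter_upwards [eventually_gt_atTop 0] with n hn
    have hn' : (0 : ℝ) < n := by exact_mod_cast hn
    rw [le_div_iff₀' hn', ← translationLength_pow]
    exact translationLength_le_dist x (a ^ n) y
  exact (hle x y).antisymm (hle y x)

end Group

section CommGroup

variable [CommGroup A] [MulAction A X] [IsIsometricSMul A X] (x : X)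

theorem translationLength_mul_le (a b : A) :
    translationLength x (a * b) ≤ translationLength x a + translationLength x b := by
  refine le_of_tendsto_of_tendsto' (tendsto_translationLength x (a * b))
    ((tendsto_translationLength x a).add (tendsto_translationLength x b)) fun n ↦ ?_
  rw [← add_div]
  gcongr
  have := dist_triangle x (a ^ n • x) ((a * b) ^ n • x)
  rwa [mul_pow, mul_smul, dist_smul, ← mul_smul, ← mul_pow] at this

/-- Averages along orbits of `A` of the distance function of `x` are moved by finitely many
prescribed elements by little more than their translation lengths. -/
theorem exists_isRadius_almost_invariant (S : Finset A) :
    ∃ f : X → ℝ, IsRadius f ∧ (∃ R, ∀ z, f z ≤ dist x z + R) ∧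
      (∀ (a : A) z, |f (a • z) - f z| ≤ dist x (a • x)) ∧
      ∀ s ∈ S, ∀ z, |f (s • z) - f z| ≤ translationLength x s + 1 := by
  classical
  induction S using Finset.induction_on with
  | empty =>
    refine ⟨fun z ↦ dist x z, fun y z ↦ ?_, ⟨0, fun z ↦ by simp⟩,
      fun a z ↦ abs_dist_smul_sub_le a x z, by simp⟩
    exact dist_triangle_left y z x
  | insert s S _ ih =>
    obtain ⟨f, hf, ⟨R, hR⟩, hA, hS⟩ := ih
    obtain ⟨n, hn, hn₀⟩ := (((tendsto_translationLength x s).eventually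
      (gt_mem_nhds (lt_add_one _))).and (eventually_gt_atTop 0)).exists
    have hn' : (0 : ℝ) < n := by exact_mod_cast hn₀
    have key : ∀ (a : A) (c : ℝ), (∀ z, |f (a • z) - f z| ≤ c) → ∀ z,
        |(∑ i ∈ Finset.range n, f (s ^ i • a • z)) / n
          - (∑ i ∈ Finset.range n, f (s ^ i • z)) / n| ≤ c := by
      intro a c h z
      rw [← sub_div, ← Finset.sum_sub_distrib, abs_div, abs_of_pos hn', div_le_iff₀ hn']
      refine (Finset.abs_sum_le_sum_abs _ _).trans ((Finset.sum_le_card_nsmul _ _ c ?_).trans ?_)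
      · intro i _
        rw [← mul_smul, mul_comm, mul_smul]
        exact h _
      · simp [mul_comm]
    refine ⟨fun z ↦ (∑ i ∈ Finset.range n, f (s ^ i • z)) / n, fun y z ↦ ?_, ?_,
      fun a ↦ key a _ (hA a), ?_⟩
    · rw [← add_div, ← Finset.sum_add_distrib, le_div_iff₀ hn']
      calc dist y z * n = ∑ i ∈ Finset.range n, dist y z := by simp [mul_comm]
        _ ≤ _ := Finset.sum_le_sum fun i _ ↦ by simpa [dist_smul] using hf (s ^ i • y) (s ^ i • z)
    · refine ⟨R + ∑ i ∈ Finset.range n, dist x (s ^ i • x), fun z ↦ ?_⟩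
      rw [div_le_iff₀ hn']
      calc ∑ i ∈ Finset.range n, f (s ^ i • z)
          ≤ ∑ i ∈ Finset.range n, (dist x z + (R + ∑ i ∈ Finset.range n, dist x (s ^ i • x))) := by
            refine Finset.sum_le_sum fun i hi ↦ ?_
            have h₁ := (abs_le.1 (hA (s ^ i) z)).2
            have h₂ := hR z
            have h₃ : dist x (s ^ i • x) ≤ ∑ i ∈ Finset.range n, dist x (s ^ i • x) :=
              Finset.single_le_sum (f := fun i ↦ dist x (s ^ i • x))
                (fun _ _ ↦ dist_nonneg) hi
            linarith
        _ = _ := by simp; ring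
    · intro t ht
      rcases Finset.mem_insert.1 ht with rfl | ht
      · intro z
        rw [← sub_div, ← Finset.sum_sub_distrib]
        have : ∑ i ∈ Finset.range n, (f (t ^ i • t • z) - f (t ^ i • z))
            = f (t ^ n • z) - f z := by
          have := Finset.sum_range_sub (fun i ↦ f (t ^ i • z)) n
          simp only [pow_succ, mul_smul, pow_zero, one_smul] at this
          exact this
        rw [this, abs_div, abs_of_pos hn']
        refine le_trans ?_ hn.le
        gcongr
        exact hA _ _
      · exact key t _ (hS t ht)

theorem CoarselyInjective.exists_dist_smul_le_of_finset (hX : CoarselyInjective X) (S : Finset A) :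
    ∃ y : X, ∀ s ∈ S, dist y (s • y) ≤ translationLength x s + 5 := by
  obtain ⟨f, hf, ⟨R, hR⟩, -, hS⟩ := exists_isRadius_almost_invariant x S
  obtain ⟨n, hn⟩ := hX.exists_iterate_approx R
  obtain ⟨y, hy⟩ := hn f hf x hR
  refine ⟨y, fun s hs ↦ ?_⟩
  have h₁ := abs_iterate_retractStep_sub_le (hf.comp_smul s) hf (hS s hs) n y
  rw [← iterate_retractStep_smul] at h₁
  have h₂ := hy y
  rw [dist_self] at h₂
  linarith [(abs_le.1 h₁).2, (abs_le.1 h₂).1, (abs_le.1 (hy (s • y))).2]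

end CommGroup

end TranslationLength

section Cocompact

theorem exists_finite_smul_eq {X G : Type*} [Group G] [MulAction G X]
    [Finite (MulAction.orbitRel.Quotient G X)] :
    ∃ F : Set X, F.Finite ∧ ∀ y : X, ∃ g : G, ∃ v ∈ F, g • v = y := by
  refine ⟨range (Quotient.out : MulAction.orbitRel.Quotient G X → X), finite_range _, fun y ↦ ?_⟩
  obtain ⟨g, hg⟩ := (MulAction.orbitRel G X).symm (Quotient.mk_out (s := MulAction.orbitRel G X) y)
  exact ⟨g, _, ⟨_, rfl⟩, hg⟩

variable {X : Type*} [PseudoMetricSpace X] {G : Type*} [Group G] [MulAction G X]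
  [IsIsometricSMul G X] [Finite (MulAction.orbitRel.Quotient G X)]

theorem exists_ncard_closedBall_le (X G : Type*) [PseudoMetricSpace X] [Group G] [MulAction G X]
    [IsIsometricSMul G X] [Finite (MulAction.orbitRel.Quotient G X)]
    (hball : ∀ (x : X) (R : ℝ), (Metric.closedBall x R).Finite)
    (R : ℝ) : ∃ N, ∀ y : X, (Metric.closedBall y R).ncard ≤ N := by
  obtain ⟨F, hF, hFG⟩ := exists_finite_smul_eq (X := X) (G := G)
  obtain ⟨N, hN⟩ := (hF.image fun v ↦ (Metric.closedBall v R).ncard).bddAbove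
  refine ⟨N, fun y ↦ ?_⟩
  obtain ⟨g, v, hv, rfl⟩ := hFG y
  refine le_trans ?_ (hN ⟨v, hv, rfl⟩)
  rw [← Metric.smul_closedBall]
  exact ncard_image_le (hball v R)

theorem exists_ncard_dist_smul_le
    (hproper : ∀ (x : X) (R : ℝ), {g : G | dist x (g • x) ≤ R}.Finite) (R : ℝ) :
    ∃ N, ∀ y : X, {g : G | dist y (g • y) ≤ R}.ncard ≤ N := by
  obtain ⟨F, hF, hFG⟩ := exists_finite_smul_eq (X := X) (G := G)
  obtain ⟨N, hN⟩ := (hF.image fun v ↦ {g : G | dist v (g • v) ≤ R}.ncard).bddAbove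
  refine ⟨N, fun y ↦ ?_⟩
  obtain ⟨g, v, hv, rfl⟩ := hFG y
  refine le_trans ?_ (hN ⟨v, hv, rfl⟩)
  refine ncard_le_ncard_of_injOn (fun h ↦ g⁻¹ * h * g) (fun h hh ↦ ?_) (fun a _ b _ h ↦ ?_)
    (hproper v R)
  · rw [mem_ofPred_eq] at hh ⊢
    rwa [mul_smul, mul_smul, ← dist_smul g, smul_inv_smul]
  · simpa using h

variable {A : Type*} [CommGroup A] [MulAction A X] [IsIsometricSMul A X]

/-- By cocompactness, a finitely generated group of isometries has only finitely many
displacement functions with prescribed bounds on the generators, so the point of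
`CoarselyInjective.exists_dist_smul_le_of_finset` can be chosen uniformly. -/
theorem CoarselyInjective.exists_dist_smul_le (hX : CoarselyInjective X) (φ : A →* G)
    (hφ : ∀ (a : A) (x : X), φ a • x = a • x)
    (hproper : ∀ (x : X) (R : ℝ), {g : G | dist x (g • x) ≤ R}.Finite) (x : X) (S : Finset A) :
    ∃ y : X, ∀ a ∈ Subgroup.closure (S : Set A), dist y (a • y) ≤ translationLength x a + 5 := by
  classical
  obtain ⟨F, hF, hFG⟩ := exists_finite_smul_eq (X := X) (G := G)
  choose g v hv hgv using hFG
  let Y : Set X := {y | ∀ s ∈ S, dist y (s • y) ≤ translationLength x s + 5}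
  let key : X → X × (S → G) := fun y ↦ (v y, fun s ↦ (g y)⁻¹ * φ s * g y)
  have hdisp (y : X) (a : A) : dist y (a • y) = dist (v y) (((g y)⁻¹ * φ a * g y) • v y) := by
    rw [mul_smul, hgv, mul_smul, hφ, ← dist_smul (g y) (v y), hgv, smul_inv_smul]
  have hfin : (key '' Y).Finite := by
    refine (hF.prod (Set.Finite.pi' (ι := S) (t := fun s ↦ ⋃ w ∈ F,
      {h : G | dist w (h • w) ≤ translationLength x (s : A) + 5})
      fun s ↦ hF.biUnion fun w _ ↦ hproper w _)).subset ?_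
    rintro _ ⟨y, hy, rfl⟩
    refine ⟨hv y, fun s ↦ mem_biUnion (hv y) ?_⟩
    rw [mem_ofPred_eq, ← hdisp]
    exact hy s s.2
  have hkey (y y' : X) (h : key y = key y') (a : A) (ha : a ∈ Subgroup.closure (S : Set A)) :
      dist y (a • y) = dist y' (a • y') := by
    have h₁ : v y = v y' := congrArg Prod.fst h
    have h₂ : (g y)⁻¹ * φ a * g y = (g y')⁻¹ * φ a * g y' := by
      have : EqOn ((MulAut.conj (g y)⁻¹).toMonoidHom.comp φ)
          ((MulAut.conj (g y')⁻¹).toMonoidHom.comp φ) (Subgroup.closure (S : Set A)) :=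
        MonoidHom.eqOn_closure fun s hs ↦ by
          simpa using congrFun (congrArg Prod.snd h) ⟨s, hs⟩
      simpa using this ha
    rw [hdisp, hdisp, h₁, h₂]
  by_contra! hbad
  choose b hb hbad using hbad
  obtain ⟨Z, -, hZ⟩ := exists_subset_bijOn Y key
  have hZfin : Z.Finite := hZ.finite_iff_finite.2 hfin
  obtain ⟨y, hy⟩ := hX.exists_dist_smul_le_of_finset x (S ∪ hZfin.toFinset.image b)
  obtain ⟨z, hz, hyz⟩ := hZ.surjOn
    (mem_image_of_mem key (show y ∈ Y from fun s hs ↦ hy s (Finset.mem_union_left _ hs)))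
  refine (hbad z).not_ge ?_
  rw [← hkey y z hyz.symm _ (hb z)]
  exact hy _ (Finset.mem_union_right _ (Finset.mem_image_of_mem b (hZfin.mem_toFinset.2 hz)))

end Cocompact

section Doubling

variable {X : Type*} [PseudoMetricSpace X] {A : Type*} [CommGroup A] [MulAction A X]
  [IsIsometricSMul A X]

/-- When `T`-th roots exist in `A`, this is the largest extension to the `T`-th root of `h` of the
function sending `k ∈ K` to the distance function of `k • x` that is `1`-Lipschitz with respect to
the translation length, shifted by a constant. -/
noncomputable def rootRadius (x : X) (K : Subgroup A) (T : ℕ) (h : A) (z : X) : ℝ :=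
  (⨅ k : K, (dist ((k : A) • x) z + translationLength x (h * ((k : A) ^ T)⁻¹) / T)) + 5 / 2

variable (x : X) (K : Subgroup A) (T : ℕ)

theorem bddBelow_rootRadius (h : A) (z : X) : BddBelow (range fun k : K ↦
    dist ((k : A) • x) z + translationLength x (h * ((k : A) ^ T)⁻¹) / T) := by
  refine ⟨0, ?_⟩
  rintro _ ⟨k, rfl⟩
  have := translationLength_nonneg x (h * ((k : A) ^ T)⁻¹)
  positivity

theorem rootRadius_le (h : A) (z : X) :
    rootRadius x K T h z ≤ dist x z + (translationLength x h / T + 5 / 2) := by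
  have := ciInf_le (bddBelow_rootRadius x K T h z) 1
  simp only [OneMemClass.coe_one, one_smul, one_pow, inv_one, mul_one] at this
  unfold rootRadius
  linarith

theorem rootRadius_le_add (h h' : A) (z : X) :
    rootRadius x K T h z ≤ rootRadius x K T h' z + translationLength x (h'⁻¹ * h) / T := by
  unfold rootRadius
  rw [add_right_comm, add_le_add_iff_right, ← sub_le_iff_le_add]
  refine le_ciInf fun k ↦ ?_
  rw [sub_le_iff_le_add]
  refine (ciInf_le (bddBelow_rootRadius x K T h z) k).trans ?_
  rw [add_assoc, add_le_add_iff_left, ← add_div]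
  gcongr
  refine le_of_eq_of_le (congrArg _ ?_) (translationLength_mul_le x _ _)
  rw [mul_assoc, mul_comm _ (h'⁻¹ * h), ← mul_assoc, mul_inv_cancel_left]

theorem abs_rootRadius_sub_le (h h' : A) (z : X) :
    |rootRadius x K T h z - rootRadius x K T h' z| ≤ translationLength x (h'⁻¹ * h) / T := by
  have h₁ := rootRadius_le_add x K T h h' z
  have h₂ := rootRadius_le_add x K T h' h z
  rw [← translationLength_inv, mul_inv_rev, inv_inv] at h₂
  rw [abs_le]
  constructor <;> linarith

theorem rootRadius_mul_pow_smul (h : A) {w : A} (hw : w ∈ K) (z : X) :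
    rootRadius x K T (h * w ^ T) (w • z) = rootRadius x K T h z := by
  unfold rootRadius
  congr 1
  rw [← (Equiv.mulLeft (⟨w, hw⟩ : K)).iInf_comp]
  refine congrArg _ (funext fun k ↦ ?_)
  simp only [Equiv.coe_mulLeft, Subgroup.coe_mul, mul_smul, dist_smul]
  congr 3
  rw [mul_pow, mul_inv, mul_assoc, mul_inv_cancel_left]

variable {x K T}

theorem isRadius_rootRadius (hT : 0 < T)
    (hx : ∀ a ∈ K, dist x (a • x) ≤ translationLength x a + 5) (h : A) :
    IsRadius (rootRadius x K T h) := by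
  have hT' : (0 : ℝ) < T := by exact_mod_cast hT
  intro y z
  have key : dist y z - 5 ≤
      (⨅ k : K, (dist ((k : A) • x) y + translationLength x (h * ((k : A) ^ T)⁻¹) / T)) +
      ⨅ k : K, (dist ((k : A) • x) z + translationLength x (h * ((k : A) ^ T)⁻¹) / T) := by
    refine le_ciInf_add_ciInf fun k l ↦ ?_
    have h₁ := hx _ (K.mul_mem (K.inv_mem k.2) l.2)
    rw [← dist_smul (k : A), mul_smul, smul_inv_smul] at h₁
    have h₂ : translationLength x ((k : A)⁻¹ * l) ≤
        translationLength x (h * ((k : A) ^ T)⁻¹) / T +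
        translationLength x (h * ((l : A) ^ T)⁻¹) / T := by
      rw [← add_div, le_div_iff₀ hT', mul_comm, ← translationLength_pow,
        ← translationLength_inv x (h * ((l : A) ^ T)⁻¹)]
      refine le_of_eq_of_le (congrArg _ ?_) (translationLength_mul_le x _ _)
      rw [mul_pow, inv_pow, mul_inv, inv_inv, mul_mul_mul_comm, mul_inv_cancel, one_mul]
    have h₃ := dist_triangle4 y ((k : A) • x) ((l : A) • x) z
    rw [dist_comm y ((k : A) • x)] at h₃
    linarith
  unfold rootRadius
  linarith

/-- Translation length is doubling on scales above `8`: for each `T`, the `T`-th roots of elements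
of `A` with translation lengths at most `16 * T` and more than `8 * T` apart are represented by
distinct points of a ball of radius `21`. -/
theorem CoarselyInjective.card_le_of_separated (hX : CoarselyInjective X) {N : ℕ}
    (hT : 0 < T) (hball : ∀ x : X, (Metric.closedBall x 21).Finite)
    (hN : ∀ x : X, (Metric.closedBall x 21).ncard ≤ N)
    (hx : ∀ a ∈ K, dist x (a • x) ≤ translationLength x a + 5) {P : Finset A}
    (hPK : ∀ h ∈ P, h ∈ K) (hP : ∀ h ∈ P, translationLength x h ≤ 16 * T)
    (hsep : ∀ h ∈ P, ∀ h' ∈ P, h ≠ h' → 8 * T < translationLength x (h⁻¹ * h')) :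
    P.card ≤ N := by
  classical
  have hT' : (0 : ℝ) < T := by exact_mod_cast hT
  have hrad := isRadius_rootRadius hT hx
  obtain ⟨n, hn⟩ := hX.exists_iterate_approx (16 + 5 / 2)
  have hle : ∀ h ∈ P, ∀ z, rootRadius x K T h z ≤ dist x z + (16 + 5 / 2) := fun h hh z ↦ by
    refine (rootRadius_le x K T h z).trans ?_
    gcongr
    rw [div_le_iff₀ hT']
    exact hP h hh
  have hex : ∀ h, ∃ y, h ∈ P → ∀ z, |dist y z - retractStep^[n] (rootRadius x K T h) z| ≤ 2 :=
    fun h ↦ by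
      by_cases hh : h ∈ P
      · obtain ⟨y, hy⟩ := hn _ (hrad h) x (hle h hh)
        exact ⟨y, fun _ ↦ hy⟩
      · exact ⟨x, fun h ↦ absurd h hh⟩
  choose y hy using hex
  have hlip (h h' : A) (z : X) := abs_iterate_retractStep_sub_le (hrad h) (hrad h')
    (abs_rootRadius_sub_le x K T h h') n z
  have hinj : InjOn y (P : Set A) := fun h hh h' hh' heq ↦ by
    by_contra hne
    have hlt := hsep h hh h' hh' hne
    obtain ⟨w, rfl⟩ : ∃ w, h' = h * w := ⟨h⁻¹ * h', by simp⟩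
    rw [inv_mul_cancel_left] at hlt
    have hwK : w ∈ K := by simpa using K.mul_mem (K.inv_mem (hPK h hh)) (hPK _ hh')
    have h₁ : retractStep^[n] (rootRadius x K T (h * w ^ T)) (w • y h)
        = retractStep^[n] (rootRadius x K T h) (y h) := by
      rw [iterate_retractStep_smul]
      exact congrArg (fun f ↦ retractStep^[n] f (y h))
        (funext (rootRadius_mul_pow_smul x K T h hwK))
    have h₂ := hlip (h * w) (h * w ^ T) (w • y h)
    have h₃ : translationLength x ((h * w ^ T)⁻¹ * (h * w)) / T
        = translationLength x w - translationLength x w / T := by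
      obtain ⟨m, rfl⟩ := Nat.exists_eq_add_of_lt hT
      rw [← translationLength_inv]
      have : ((h * w ^ (0 + m + 1))⁻¹ * (h * w))⁻¹ = w ^ m := by
        rw [zero_add, pow_succ]
        group
      rw [this, translationLength_pow]
      field_simp
      push_cast
      ring
    have h₄ := translationLength_le_dist x w (y h)
    have h₅ := hy h hh (y h)
    have h₆ := hy _ hh' (w • y h)
    rw [← heq] at h₆
    rw [dist_self] at h₅
    rw [h₃, h₁] at h₂
    have h₇ : 8 < translationLength x w / T := by rwa [lt_div_iff₀ hT']
    linarith [(abs_le.1 h₂).2, (abs_le.1 h₅).1, (abs_le.1 h₆).2]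
  rw [← Finset.card_image_of_injOn hinj, ← ncard_coe_finset]
  refine (ncard_le_ncard ?_ (hball x)).trans (hN x)
  intro p hp
  obtain ⟨h, hh, rfl⟩ := Finset.mem_image.1 (Finset.mem_coe.1 hp)
  have h₁ := (abs_le.1 (hy h hh x)).2
  have h₂ := (hrad h).iterate_retractStep_le n x
  have h₃ := hle h hh x
  rw [dist_self] at h₃
  rw [Metric.mem_closedBall]
  linarith

end Doubling

section DoublingNorm

variable {A : Type*} [AddCommGroup A] {τ : A → ℝ}

/-- If separated subsets of balls of radius `2 * r` have at most `N` elements, then balls of radius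
`2 * r` have at most `N` times as many elements as balls of radius `r`. -/
theorem ncard_le_mul_ncard (hfin : ∀ R : ℝ, {a | τ a ≤ R}.Finite) {r : ℝ} {N : ℕ}
    (hr : 0 ≤ r) (hzero : τ 0 = 0) (hneg : ∀ a, τ (-a) = τ a)
    (hsep : ∀ P : Finset A, (∀ p ∈ P, τ p ≤ 2 * r) →
      (∀ p ∈ P, ∀ q ∈ P, p ≠ q → r < τ (-p + q)) → P.card ≤ N) :
    {a | τ a ≤ 2 * r}.ncard ≤ N * {a | τ a ≤ r}.ncard := by
  classical
  let B := (hfin (2 * r)).toFinset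
  let B' := (hfin r).toFinset
  let Sep : Finset A → Prop := fun P ↦ ∀ p ∈ P, ∀ q ∈ P, p ≠ q → r < τ (-p + q)
  let Q := B.powerset.filter Sep
  obtain ⟨P, hPQ, hPmax⟩ := Q.exists_max_image Finset.card ⟨∅, by simp [Q, Sep]⟩
  obtain ⟨hPB, hPsep⟩ := Finset.mem_filter.1 hPQ
  rw [Finset.mem_powerset] at hPB
  have hcover : B ⊆ P.biUnion fun p ↦ B'.image (p + ·) := by
    intro b hb
    by_contra hcon
    have hfar : ∀ p ∈ P, r < τ (-p + b) := fun p hp ↦ by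
      by_contra! h
      exact hcon (Finset.mem_biUnion.2 ⟨p, hp, Finset.mem_image.2
        ⟨-p + b, by simpa [B'] using h, by abel⟩⟩)
    have hbP : b ∉ P := fun h ↦ by
      have := hfar b h
      rw [neg_add_cancel, hzero] at this
      linarith
    have hins : insert b P ∈ Q := by
      refine Finset.mem_filter.2 ⟨Finset.mem_powerset.2 (Finset.insert_subset hb hPB), ?_⟩
      intro p hp q hq hpq
      rcases Finset.mem_insert.1 hp with rfl | hp' <;> rcases Finset.mem_insert.1 hq with rfl | hq'
      · exact absurd rfl hpq
      · rw [← hneg, neg_add_rev, neg_neg]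
        exact hfar q hq'
      · exact hfar p hp'
      · exact hPsep p hp' q hq' hpq
    have := hPmax _ hins
    rw [Finset.card_insert_of_notMem hbP] at this
    omega
  rw [ncard_eq_toFinset_card _ (hfin (2 * r)), ncard_eq_toFinset_card _ (hfin r)]
  refine (Finset.card_le_card hcover).trans ((Finset.card_biUnion_le_card_mul _ _ B'.card
    fun p _ ↦ Finset.card_image_le).trans ?_)
  gcongr
  exact hsep P (fun p hp ↦ by simpa [B] using hPB hp) hPsep

theorem map_zsmul_eq (hneg : ∀ a, τ (-a) = τ a) (hsmul : ∀ (n : ℕ) a, τ (n • a) = n * τ a)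
    (m : ℤ) (a : A) : τ (m • a) = |(m : ℝ)| * τ a := by
  obtain ⟨n, rfl | rfl⟩ := m.eq_nat_or_neg
  · simpa using hsmul n a
  · simpa [hneg] using hsmul n a

theorem map_sum_zsmul_le (hzero : τ 0 = 0) (hneg : ∀ a, τ (-a) = τ a)
    (hadd : ∀ a b, τ (a + b) ≤ τ a + τ b) (hsmul : ∀ (n : ℕ) a, τ (n • a) = n * τ a)
    {ι : Type*} (s : Finset ι) (c : ι → ℤ) (v : ι → A) :
    τ (∑ i ∈ s, c i • v i) ≤ ∑ i ∈ s, |(c i : ℝ)| * τ (v i) := by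
  refine (Finset.le_sum_of_subadditive τ hzero.le hadd s _).trans
    (Finset.sum_le_sum fun i _ ↦ ?_)
  exact (map_zsmul_eq hneg hsmul _ _).le

/-- An abelian group with a homogeneous seminorm with finite balls which is doubling on large
scales is finitely generated. -/
theorem fg_of_doubling (hnonneg : ∀ a, 0 ≤ τ a) (hneg : ∀ a, τ (-a) = τ a)
    (hadd : ∀ a b, τ (a + b) ≤ τ a + τ b) (hsmul : ∀ (n : ℕ) a, τ (n • a) = n * τ a)
    (hfin : ∀ R : ℝ, {a | τ a ≤ R}.Finite) {c : ℝ} (hc : 0 < c) {N : ℕ}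
    (hsep : ∀ T : ℕ, 0 < T → ∀ P : Finset A, (∀ p ∈ P, τ p ≤ 2 * (c * T)) →
      (∀ p ∈ P, ∀ q ∈ P, p ≠ q → c * T < τ (-p + q)) → P.card ≤ N) :
    AddGroup.FG A := by
  classical
  have hzero : τ 0 = 0 := by simpa using hsmul 0 0
  have hN : 0 < N := by
    have := hsep 1 one_pos {0} (by simp [hzero]; positivity) (by simp)
    rwa [Finset.card_singleton] at this
  have hgrowth (T : ℕ) (hT : 0 < T) (j : ℕ) :
      {a | τ a ≤ 2 ^ j * (c * T)}.ncard ≤ N ^ j * {a | τ a ≤ c * T}.ncard := by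
    induction j with
    | zero => simp
    | succ j ih =>
      have h := ncard_le_mul_ncard hfin (r := c * (2 ^ j * T : ℕ)) (by positivity) hzero hneg
        (hsep (2 ^ j * T) (by positivity))
      have h₁ : c * (2 ^ j * T : ℕ) = 2 ^ j * (c * T) := by push_cast; ring
      rw [h₁, ← mul_assoc, ← pow_succ'] at h
      refine h.trans ?_
      rw [pow_succ', mul_assoc]
      gcongr
  have hcard (s : Finset A) (hs : LinearIndepOn ℤ id (s : Set A)) : s.card ≤ N := by
    by_contra! hlt
    obtain ⟨T, hT⟩ := exists_nat_gt (max 0 ((∑ a ∈ s, τ a) / c))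
    have hT₀ : 0 < T := by exact_mod_cast (le_max_left _ _).trans_lt hT
    have hT₁ : ∑ a ∈ s, τ a ≤ c * T := by
      rw [← div_le_iff₀' hc]
      exact ((le_max_right _ _).trans_lt hT).le
    have hbox (j : ℕ) : (2 ^ j) ^ s.card ≤ {a | τ a ≤ 2 ^ j * (c * T)}.ncard := by
      let Φ : (s → Fin (2 ^ j)) → A := fun k ↦ ∑ a : s, ((k a : ℕ) : ℤ) • (a : A)
      have hΦ : Function.Injective Φ := by
        intro k l hkl
        have h : ∑ a : s, (((k a : ℕ) : ℤ) - ((l a : ℕ) : ℤ)) • (a : A) = 0 := by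
          simp only [sub_smul, Finset.sum_sub_distrib]
          exact sub_eq_zero.2 hkl
        have h₁ := Fintype.linearIndependent_iff.1 hs _ h
        refine funext fun a ↦ Fin.ext ?_
        have := h₁ a
        omega
      calc (2 ^ j) ^ s.card = (range Φ).ncard := by
            rw [← image_univ, ncard_image_of_injective _ hΦ, ncard_univ]
            simp
        _ ≤ _ := ncard_le_ncard ?_ (hfin _)
      rintro _ ⟨k, rfl⟩
      rw [mem_ofPred_eq]
      refine (map_sum_zsmul_le hzero hneg hadd hsmul _ _ _).trans ?_
      calc ∑ a : s, |(((k a : ℕ) : ℤ) : ℝ)| * τ a ≤ ∑ a : s, 2 ^ j * τ (a : A) := by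
            refine Finset.sum_le_sum fun a _ ↦ mul_le_mul_of_nonneg_right ?_ (hnonneg _)
            rw [Int.cast_natCast, Nat.abs_cast]
            exact_mod_cast (k a).2.le
        _ = 2 ^ j * ∑ a ∈ s, τ a := by rw [← Finset.mul_sum, Finset.sum_coe_sort s τ]
        _ ≤ _ := by gcongr
    set C := {a | τ a ≤ c * T}.ncard
    have hbound (j : ℕ) : 2 ^ j ≤ C := by
      have h₁ := (hbox j).trans (hgrowth T hT₀ j)
      have h₂ : 2 * N ≤ 2 ^ s.card := by
        calc 2 * N ≤ 2 * 2 ^ N := by gcongr; exact Nat.lt_two_pow_self.le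
          _ = 2 ^ (N + 1) := by rw [pow_succ']
          _ ≤ _ := Nat.pow_le_pow_right two_pos hlt
      refine Nat.le_of_mul_le_mul_left ?_ (pow_pos hN j)
      calc N ^ j * 2 ^ j = (2 * N) ^ j := by rw [mul_pow, mul_comm]
        _ ≤ (2 ^ s.card) ^ j := Nat.pow_le_pow_left h₂ j
        _ = (2 ^ j) ^ s.card := by rw [← pow_mul, ← pow_mul, mul_comm]
        _ ≤ _ := h₁
    exact (hbound C).not_gt Nat.lt_two_pow_self
  obtain ⟨s, hs, hmax⟩ := exists_maximal_linearIndepOn ℤ (id : A → A)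
  have hsfin : s.Finite := by
    by_contra hinf
    obtain ⟨t, hts, htcard⟩ := Set.Infinite.exists_subset_card_eq hinf (N + 1)
    have := hcard t (hs.mono hts)
    omega
  lift s to Finset A using hsfin
  have hspan (a : A) : ∃ m : ℤ, m ≠ 0 ∧ ∃ k : A → ℤ, ∑ i ∈ s, k i • i = m • a := by
    by_cases ha : a ∈ (s : Set A)
    · exact ⟨1, one_ne_zero, fun i ↦ if i = a then 1 else 0, by
        simp [ite_smul, Finset.mem_coe.1 ha]⟩
    · obtain ⟨m, hm, hma⟩ := hmax a ha
      rw [image_id, id, Submodule.mem_span_finset] at hma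
      obtain ⟨k, -, hk⟩ := hma
      exact ⟨m, hm, k, hk⟩
  let D := ∑ i ∈ s, τ i
  refine AddGroup.fg_iff.2 ⟨s ∪ {a | τ a ≤ D}, ?_, s.finite_toSet.union (hfin D)⟩
  rw [eq_top_iff]
  intro a _
  obtain ⟨m, hm, k, hk⟩ := hspan a
  have hrem : m • (a - ∑ i ∈ s, (k i / m) • i) = ∑ i ∈ s, (k i % m) • i := by
    rw [smul_sub, ← hk, Finset.smul_sum, ← Finset.sum_sub_distrib]
    refine Finset.sum_congr rfl fun i _ ↦ ?_
    rw [← mul_smul, ← sub_smul, Int.emod_def]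
  have hm' : (0 : ℝ) < |(m : ℝ)| := by
    rw [abs_pos]
    exact_mod_cast hm
  have hτ : τ (a - ∑ i ∈ s, (k i / m) • i) ≤ D := by
    refine le_of_mul_le_mul_left ?_ hm'
    calc |(m : ℝ)| * τ (a - ∑ i ∈ s, (k i / m) • i)
        = τ (m • (a - ∑ i ∈ s, (k i / m) • i)) := (map_zsmul_eq hneg hsmul _ _).symm
      _ ≤ ∑ i ∈ s, |((k i % m : ℤ) : ℝ)| * τ i := by
          rw [hrem]
          exact map_sum_zsmul_le hzero hneg hadd hsmul _ _ _
      _ ≤ ∑ i ∈ s, |(m : ℝ)| * τ i := by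
          refine Finset.sum_le_sum fun i _ ↦ mul_le_mul_of_nonneg_right ?_ (hnonneg _)
          have h₁ := Int.emod_nonneg (k i) hm
          have h₂ := Int.emod_lt_abs (k i) hm
          rw [← Int.cast_abs, ← Int.cast_abs, abs_of_nonneg h₁]
          exact_mod_cast h₂.le
      _ = _ := by rw [← Finset.mul_sum]
  rw [← sub_add_cancel a (∑ i ∈ s, (k i / m) • i)]
  refine add_mem (AddSubgroup.subset_closure (mem_union_right _ hτ)) (sum_mem fun i hi ↦ ?_)
  exact zsmul_mem (AddSubgroup.subset_closure (mem_union_left _ hi)) _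

end DoublingNorm

/-- Abelian groups of isometries, contained in a group acting properly and cocompactly on a proper
discrete coarsely injective space, are finitely generated. -/
theorem CoarselyInjective.group_fg {X : Type*} [PseudoMetricSpace X] [Nonempty X] {G : Type*}
    [Group G] [MulAction G X] [IsIsometricSMul G X] [Finite (MulAction.orbitRel.Quotient G X)]
    {A : Type*} [CommGroup A] [MulAction A X] [IsIsometricSMul A X]
    (hX : CoarselyInjective X) (φ : A →* G) (hφinj : Function.Injective φ)
    (hφ : ∀ (a : A) (x : X), φ a • x = a • x)
    (hproper : ∀ (x : X) (R : ℝ), {g : G | dist x (g • x) ≤ R}.Finite)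
    (hball : ∀ (x : X) (R : ℝ), (Metric.closedBall x R).Finite) :
    Group.FG A := by
  obtain ⟨x⟩ := ‹Nonempty X›
  obtain ⟨N, hN⟩ := exists_ncard_closedBall_le X G hball 21
  have hfin (R : ℝ) : {a : A | translationLength x a ≤ R}.Finite := by
    obtain ⟨M, hM⟩ := exists_ncard_dist_smul_le hproper (R + 5)
    by_contra hinf
    obtain ⟨S, hS, hScard⟩ := Set.Infinite.exists_subset_card_eq hinf (M + 1)
    obtain ⟨y, hy⟩ := hX.exists_dist_smul_le_of_finset x S
    have h : (φ '' S).ncard ≤ M := by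
      refine (ncard_le_ncard ?_ (hproper y (R + 5))).trans (hM y)
      rintro _ ⟨a, ha, rfl⟩
      rw [mem_ofPred_eq, hφ]
      exact (hy a ha).trans (add_le_add_left (hS ha) 5)
    rw [ncard_image_of_injective _ hφinj, ncard_coe_finset] at h
    omega
  rw [GroupFG.iff_add_fg]
  refine fg_of_doubling (τ := fun a : Additive A ↦ translationLength x a.toMul)
    (fun a ↦ translationLength_nonneg x _) (fun a ↦ translationLength_inv x _)
    (fun a b ↦ translationLength_mul_le x _ _) (fun n a ↦ translationLength_pow x _ n)
    hfin (c := 8) (by norm_num) (N := N) fun T hT P hP hsep ↦ ?_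
  let P' : Finset A := P.map Additive.toMul.toEmbedding
  obtain ⟨y, hy⟩ := hX.exists_dist_smul_le φ hφ hproper x P'
  have hbase (a : A) : translationLength y a = translationLength x a :=
    translationLength_eq y x a
  rw [← Finset.card_map Additive.toMul.toEmbedding]
  refine hX.card_le_of_separated (x := y) hT (fun z ↦ hball z 21) hN
    (K := Subgroup.closure (P' : Set A)) (P := P') ?_ ?_ ?_ ?_
  · simpa only [hbase] using hy
  · exact fun h hh ↦ Subgroup.subset_closure hh
  · intro h hh
    rw [hbase]
    refine (hP (Additive.ofMul h) (by simpa [P'] using hh)).trans_eq ?_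
    ring
  · intro h hh h' hh' hne
    rw [hbase]
    exact hsep (Additive.ofMul h) (by simpa [P'] using hh) (Additive.ofMul h')
      (by simpa [P'] using hh') (by simpa using hne)

section Graph

variable {V : Type*} {Γ : SimpleGraph V}

theorem exists_dist_le_dist_le (hconn : Γ.Connected) {u v : V} {r s : ℕ}
    (h : Γ.dist u v ≤ r + s) : ∃ w, Γ.dist u w ≤ r ∧ Γ.dist v w ≤ s := by
  obtain ⟨p, hp⟩ := hconn.exists_walk_length_eq_dist u v
  refine ⟨p.getVert r, (Γ.dist_le (p.take r)).trans (by simp), ?_⟩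
  rw [SimpleGraph.dist_comm]
  refine (Γ.dist_le (p.drop r)).trans ?_
  rw [SimpleGraph.Walk.drop_length]
  omega

theorem finite_dist_le (hconn : Γ.Connected) (hlf : ∀ v : V, (Γ.neighborSet v).Finite)
    (v : V) (n : ℕ) : {u | Γ.dist v u ≤ n}.Finite := by
  induction n with
  | zero =>
    refine (finite_singleton v).subset fun u hu ↦ ?_
    exact (hconn.dist_eq_zero_iff.1 (Nat.le_zero.1 hu)).symm
  | succ n ih =>
    refine (ih.union (ih.biUnion fun u _ ↦ hlf u)).subset fun u hu ↦ ?_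
    obtain ⟨w, hvw, huw⟩ := exists_dist_le_dist_le hconn (r := n) (s := 1) hu
    rcases Nat.le_one_iff_eq_zero_or_eq_one.1 huw with h | h
    · rw [hconn.dist_eq_zero_iff.1 h]
      exact Or.inl hvw
    · exact Or.inr (mem_biUnion hvw (SimpleGraph.dist_eq_one_iff_adj.1 h).symm)

theorem countable_of_locallyFinite (hconn : Γ.Connected)
    (hlf : ∀ v : V, (Γ.neighborSet v).Finite) : Countable V := by
  obtain ⟨v⟩ := hconn.nonempty
  rw [← countable_univ_iff]
  refine (countable_iUnion fun n ↦ (finite_dist_le hconn hlf v n).countable).mono fun u _ ↦ ?_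
  exact mem_iUnion.2 ⟨Γ.dist v u, le_refl (Γ.dist v u)⟩

theorem dist_smul_of_adj_iff {G : Type*} [Group G] [MulAction G V]
    (hauto : ∀ (g : G) (u v : V), Γ.Adj (g • u) (g • v) ↔ Γ.Adj u v) (hconn : Γ.Connected)
    (g : G) (u v : V) : Γ.dist (g • u) (g • v) = Γ.dist u v := by
  have hle (g : G) (u v : V) : Γ.dist (g • u) (g • v) ≤ Γ.dist u v := by
    obtain ⟨p, hp⟩ := hconn.exists_walk_length_eq_dist u v
    let f : Γ →g Γ := ⟨fun w ↦ g • w, fun h ↦ (hauto g _ _).2 h⟩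
    rw [← hp, ← SimpleGraph.Walk.length_map f p]
    exact Γ.dist_le (p.map f)
  refine (hle g u v).antisymm ?_
  simpa using hle g⁻¹ (g • u) (g • v)

/-- The vertex set of a connected graph with the graph metric. -/
noncomputable abbrev graphMetric (hconn : Γ.Connected) : PseudoMetricSpace V where
  dist u v := Γ.dist u v
  dist_self u := by simp
  dist_comm u v := by rw [SimpleGraph.dist_comm]
  dist_triangle u v w := by exact_mod_cast hconn.dist_triangle

end Graph

end CoarseHelly

/-- Abelian subgroups of Helly groups are finitely generated.

Here a Helly group is a group `G` acting geometrically (properly and cocompactly, by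
graph automorphisms) on a Helly graph: a connected, locally finite simple graph `Γ` such
that every family of pairwise intersecting balls has nonempty total intersection. -/
theorem abelian_subgroups_of_helly_groups_are_fg
    {G : Type*} [Group G] {V : Type*} (Γ : SimpleGraph V)
    (hconn : Γ.Connected)
    (hlf : ∀ v : V, (Γ.neighborSet v).Finite)
    (hHelly : ∀ {ι : Type*} (c : ι → V) (r : ι → ℕ),
      (∀ i j : ι,
        ({u : V | Γ.dist (c i) u ≤ r i} ∩ {u : V | Γ.dist (c j) u ≤ r j}).Nonempty) →
      (⋂ i : ι, {u : V | Γ.dist (c i) u ≤ r i}).Nonempty)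
    [MulAction G V]
    (hauto : ∀ (g : G) (u v : V), Γ.Adj (g • u) (g • v) ↔ Γ.Adj u v)
    (hproper : ∀ (v : V) (r : ℕ), {g : G | Γ.dist v (g • v) ≤ r}.Finite)
    (hcocompact : Finite (MulAction.orbitRel.Quotient G V)) :
    ∀ H : Subgroup G, (∀ a b : H, a * b = b * a) → H.FG := by
  intro H hcomm
  let : PseudoMetricSpace V := CoarseHelly.graphMetric hconn
  have hdist (u v : V) : dist u v = Γ.dist u v := rfl
  have : Nonempty V := hconn.nonempty
  have : Countable V := CoarseHelly.countable_of_locallyFinite hconn hlf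
  let : CommGroup H := { (inferInstance : Group H) with mul_comm := hcomm }
  have : IsIsometricSMul G V := ⟨fun g ↦ Isometry.of_dist_eq fun u v ↦ by
    rw [hdist, hdist, CoarseHelly.dist_smul_of_adj_iff hauto hconn]⟩
  have : IsIsometricSMul H V := ⟨fun h ↦ isometry_smul V (h : G)⟩
  have hX : CoarseHelly.CoarselyInjective V := by
    intro f hf
    have hf₀ (z : V) : 0 ≤ f z := by
      have := hf z z
      rw [dist_self] at this
      linarith
    obtain ⟨e, he⟩ := exists_surjective_nat V
    obtain ⟨p, hp⟩ := hHelly (fun i : ULift ℕ ↦ e i.down) (fun i ↦ ⌈f (e i.down)⌉₊) fun i j ↦ by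
      refine CoarseHelly.exists_dist_le_dist_le hconn ?_
      have h := hf (e i.down) (e j.down)
      rw [hdist] at h
      have h₁ := Nat.le_ceil (f (e i.down))
      have h₂ := Nat.le_ceil (f (e j.down))
      exact_mod_cast h.trans (add_le_add h₁ h₂)
    refine ⟨p, fun z ↦ ?_⟩
    obtain ⟨n, rfl⟩ := he z
    have h : Γ.dist (e n) p ≤ ⌈f (e n)⌉₊ := Set.mem_iInter.1 hp (ULift.up n)
    rw [dist_comm, hdist]
    exact (Nat.cast_le.2 h).trans (Nat.ceil_lt_add_one (hf₀ _)).le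
  rw [← Group.fg_iff_subgroup_fg]
  refine hX.group_fg H.subtype H.subtype_injective (fun _ _ ↦ rfl) (fun v R ↦ ?_) fun v R ↦ ?_
  · exact (hproper v ⌊R⌋₊).subset fun g hg ↦ Nat.le_floor hg
  · refine (CoarseHelly.finite_dist_le hconn hlf v ⌊R⌋₊).subset fun u hu ↦ Nat.le_floor ?_
    rw [← hdist, dist_comm]
    exact hu
end

section
/- Let G be a Helly group, i.e. a group acting geometrically on a Helly graph. Then every soluble subgroup of G is virtually abelian, i.e. contains an abelian subgroup of finite index. -/
section Extremal

variable {X : Type*} [PseudoMetricSpace X]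

/-- The functions `f` whose balls `closedBall x (f x)` satisfy the pairwise numerical condition
for intersecting in a geodesic space. -/
def IsMajorant (f : X → ℝ) : Prop := ∀ x y, dist x y ≤ f x + f y

/-- The points of the injective hull of `X`: the majorants that cannot be lowered anywhere. -/
def IsExtremal (f : X → ℝ) : Prop :=
  IsMajorant f ∧ ∀ x, ∀ ε > 0, ∃ z, f x + f z ≤ dist x z + ε

/-- The least value at `x` allowed by the values of `f`. -/
noncomputable def dualFunction (f : X → ℝ) (x : X) : ℝ := ⨆ z, (dist x z - f z)

/-- The mean of a function and its dual. -/
noncomputable def lowering (f : X → ℝ) (x : X) : ℝ := (f x + dualFunction f x) / 2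

theorem IsMajorant.bddAbove {f : X → ℝ} (hf : IsMajorant f) (x : X) :
    BddAbove (Set.range fun z => dist x z - f z) := by
  refine ⟨f x, ?_⟩
  rintro _ ⟨z, rfl⟩
  have := hf x z
  simp only
  linarith

theorem IsMajorant.nonneg {f : X → ℝ} (hf : IsMajorant f) (x : X) : 0 ≤ f x := by
  have := hf x x
  rw [dist_self] at this
  linarith

theorem IsMajorant.le_dualFunction {f : X → ℝ} (hf : IsMajorant f) (x z : X) :
    dist x z - f z ≤ dualFunction f x :=
  le_ciSup (hf.bddAbove x) z

theorem dualFunction_le {f : X → ℝ} {x : X} {r : ℝ} (h : ∀ z, dist x z - f z ≤ r) :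
    dualFunction f x ≤ r :=
  have : Nonempty X := ⟨x⟩
  ciSup_le h

theorem IsMajorant.dualFunction_le_self {f : X → ℝ} (hf : IsMajorant f) (x : X) :
    dualFunction f x ≤ f x :=
  dualFunction_le fun z => by linarith [hf x z]

theorem IsMajorant.lowering {f : X → ℝ} (hf : IsMajorant f) : IsMajorant (lowering f) := by
  intro x y
  have h1 := hf.le_dualFunction x y
  have h2 := hf.le_dualFunction y x
  rw [dist_comm y x] at h2
  unfold _root_.lowering
  linarith

theorem IsMajorant.lowering_le {f : X → ℝ} (hf : IsMajorant f) (x : X) :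
    _root_.lowering f x ≤ f x := by
  have := hf.dualFunction_le_self x
  unfold _root_.lowering
  linarith

theorem IsMajorant.gap_lowering_le {f : X → ℝ} (hf : IsMajorant f) (x : X) :
    _root_.lowering f x - dualFunction (_root_.lowering f) x ≤ (f x - dualFunction f x) / 2 := by
  have h : dualFunction f x ≤ dualFunction (_root_.lowering f) x :=
    dualFunction_le fun z => by
      linarith [hf.lowering.le_dualFunction x z, hf.lowering_le z]
  have : _root_.lowering f x = (f x + dualFunction f x) / 2 := rfl
  linarith

theorem abs_lowering_sub_le {f g : X → ℝ} (hf : IsMajorant f) (hg : IsMajorant g) {r : ℝ}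
    (h : ∀ x, |f x - g x| ≤ r) (x : X) : |lowering f x - lowering g x| ≤ r := by
  have h1 : dualFunction f x ≤ dualFunction g x + r := dualFunction_le fun z => by
    linarith [hg.le_dualFunction x z, (abs_le.1 (h z)).1]
  have h2 : dualFunction g x ≤ dualFunction f x + r := dualFunction_le fun z => by
    linarith [hf.le_dualFunction x z, (abs_le.1 (h z)).2]
  have := abs_le.1 (h x)
  unfold lowering
  rw [abs_le]
  constructor <;> linarith

theorem lowering_comp (σ : X ≃ᵢ X) (f : X → ℝ) : lowering (f ∘ σ) = lowering f ∘ σ := by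
  have h : ∀ x, dualFunction (f ∘ σ) x = dualFunction f (σ x) := fun x => by
    unfold dualFunction
    refine σ.surjective.iSup_congr σ fun z => ?_
    rw [σ.dist_eq]
    rfl
  funext x
  simp only [lowering, h, Function.comp_apply]

theorem IsMajorant.iterate_lowering {f : X → ℝ} (hf : IsMajorant f) (n : ℕ) :
    IsMajorant (_root_.lowering^[n] f) := by
  induction n with
  | zero => exact hf
  | succ n ih =>
    rw [Function.iterate_succ_apply']
    exact ih.lowering

/-- The pointwise limit of the iterated lowerings. -/
noncomputable def extremalRetraction (f : X → ℝ) (x : X) : ℝ := ⨅ n : ℕ, (lowering^[n] f) x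

theorem IsMajorant.extremalRetraction_le {f : X → ℝ} (hf : IsMajorant f) (n : ℕ) (x : X) :
    extremalRetraction f x ≤ (_root_.lowering^[n] f) x :=
  ciInf_le ⟨0, by rintro _ ⟨k, rfl⟩; exact (hf.iterate_lowering k).nonneg x⟩ n

theorem IsMajorant.iterate_lowering_antitone {f : X → ℝ} (hf : IsMajorant f) (x : X) :
    Antitone fun n => (_root_.lowering^[n] f) x :=
  antitone_nat_of_succ_le fun n => by
    rw [Function.iterate_succ_apply']
    exact (hf.iterate_lowering n).lowering_le x

theorem IsMajorant.isExtremal_extremalRetraction {f : X → ℝ} (hf : IsMajorant f) :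
    IsExtremal (extremalRetraction f) := by
  have gap : ∀ x n, (_root_.lowering^[n] f) x - dualFunction (_root_.lowering^[n] f) x ≤
      (f x - dualFunction f x) * (1 / 2) ^ n := by
    intro x n
    induction n with
    | zero => simp
    | succ n ih =>
      rw [Function.iterate_succ_apply', pow_succ]
      linarith [(hf.iterate_lowering n).gap_lowering_le x]
  refine ⟨fun x y => ?_, fun x ε hε => ?_⟩
  · by_contra! hlt
    obtain ⟨m, hm⟩ := exists_lt_of_ciInf_lt
      (show extremalRetraction f x < dist x y - extremalRetraction f y by linarith)
    obtain ⟨n, hn⟩ := exists_lt_of_ciInf_lt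
      (show extremalRetraction f y < dist x y - (_root_.lowering^[m] f) x by linarith)
    have h1 := hf.iterate_lowering_antitone x (le_max_left m n)
    have h2 := hf.iterate_lowering_antitone y (le_max_right m n)
    have h3 := hf.iterate_lowering (max m n) x y
    simp only at h1 h2
    linarith
  · have hlim : Filter.Tendsto (fun n : ℕ => (f x - dualFunction f x) * (1 / 2 : ℝ) ^ n)
        Filter.atTop (nhds ((f x - dualFunction f x) * 0)) :=
      (tendsto_pow_atTop_nhds_zero_of_lt_one (by norm_num) (by norm_num)).const_mul _
    rw [mul_zero] at hlim
    obtain ⟨n, hn⟩ := (hlim.eventually (gt_mem_nhds (half_pos hε))).exists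
    have : Nonempty X := ⟨x⟩
    obtain ⟨z, hz⟩ := exists_lt_of_lt_ciSup
      (show dualFunction (_root_.lowering^[n] f) x - ε / 2 < dualFunction (_root_.lowering^[n] f) x
        by linarith)
    refine ⟨z, ?_⟩
    linarith [gap x n, hf.extremalRetraction_le n x, hf.extremalRetraction_le n z]

theorem abs_extremalRetraction_sub_le {f g : X → ℝ} (hf : IsMajorant f) (hg : IsMajorant g) {r : ℝ}
    (h : ∀ x, |f x - g x| ≤ r) (x : X) :
    |extremalRetraction f x - extremalRetraction g x| ≤ r := by
  have key : ∀ n : ℕ, ∀ x, |(lowering^[n] f) x - (lowering^[n] g) x| ≤ r := by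
    intro n
    induction n with
    | zero => exact h
    | succ n ih =>
      simp only [Function.iterate_succ_apply']
      exact abs_lowering_sub_le (hf.iterate_lowering n) (hg.iterate_lowering n) ih
  have h1 : extremalRetraction f x - r ≤ extremalRetraction g x := le_ciInf fun n => by
    linarith [hf.extremalRetraction_le n x, (abs_le.1 (key n x)).2]
  have h2 : extremalRetraction g x - r ≤ extremalRetraction f x := le_ciInf fun n => by
    linarith [hg.extremalRetraction_le n x, (abs_le.1 (key n x)).1]
  rw [abs_le]
  constructor <;> linarith

theorem extremalRetraction_comp (σ : X ≃ᵢ X) (f : X → ℝ) :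
    extremalRetraction (f ∘ σ) = extremalRetraction f ∘ σ := by
  have key : ∀ n : ℕ, lowering^[n] (f ∘ σ) = lowering^[n] f ∘ σ := by
    intro n
    induction n with
    | zero => rfl
    | succ n ih => rw [Function.iterate_succ_apply', Function.iterate_succ_apply', ih,
        lowering_comp]
  funext x
  simp only [extremalRetraction, key, Function.comp_apply]

/-- Every majorant is, up to an error of `1`, bounded below by the distance to a point. -/
def IsCoarselyInjective (X : Type*) [PseudoMetricSpace X] : Prop :=
  ∀ f : X → ℝ, IsMajorant f → ∃ w, ∀ x, dist w x ≤ f x + 1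

theorem IsCoarselyInjective.exists_abs_sub_dist_le (hX : IsCoarselyInjective X) {f : X → ℝ}
    (hf : IsExtremal f) : ∃ w, ∀ x, |f x - dist w x| ≤ 1 := by
  obtain ⟨w, hw⟩ := hX f hf.1
  refine ⟨w, fun x => ?_⟩
  have : f x ≤ dist w x + 1 := le_of_forall_pos_le_add fun ε hε => by
    obtain ⟨z, hz⟩ := hf.2 x ε hε
    have := hw z
    have := dist_triangle x w z
    rw [dist_comm x w] at this
    linarith
  rw [abs_le]
  constructor <;> linarith [hw x]

end Extremal

section Averaging

variable {U X : Type*} [AddCommGroup U]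

/-- The mean of `n` translates of `φ` along multiples of `b`. -/
noncomputable def translateMean (n : ℕ) (b : U) (φ : U → X → ℝ) (u : U) (x : X) : ℝ :=
  (∑ j ∈ Finset.range n, φ (u + j • b) x) / n

theorem abs_translateMean_add_sub_le {φ : U → X → ℝ} {c : U} {R : ℝ}
    (h : ∀ u x, |φ (u + c) x - φ u x| ≤ R) {n : ℕ} (hn : 0 < n) (b u : U) (x : X) :
    |translateMean n b φ (u + c) x - translateMean n b φ u x| ≤ R := by
  have hn' : (0 : ℝ) < n := by exact_mod_cast hn
  unfold translateMean
  rw [← sub_div, ← Finset.sum_sub_distrib, abs_div, abs_of_pos hn', div_le_iff₀ hn']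
  calc |∑ j ∈ Finset.range n, (φ (u + c + j • b) x - φ (u + j • b) x)|
      ≤ ∑ j ∈ Finset.range n, |φ (u + c + j • b) x - φ (u + j • b) x| :=
        Finset.abs_sum_le_sum_abs _ _
    _ ≤ ∑ j ∈ Finset.range n, R := Finset.sum_le_sum fun j _ => by
        rw [add_right_comm]; exact h _ _
    _ = R * n := by simp [mul_comm]

theorem abs_translateMean_add_self_sub_le {φ : U → X → ℝ} {b : U} {R : ℝ} {n : ℕ} (hn : 0 < n)
    (h : ∀ u x, |φ (u + n • b) x - φ u x| ≤ n * R) (u : U) (x : X) :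
    |translateMean n b φ (u + b) x - translateMean n b φ u x| ≤ R := by
  have hn' : (0 : ℝ) < n := by exact_mod_cast hn
  have : ∀ j : ℕ, φ (u + b + j • b) x = φ (u + (j + 1) • b) x := fun j => by
    rw [add_smul, one_smul]; congr 1; abel
  unfold translateMean
  simp only [this]
  rw [← sub_div, ← Finset.sum_sub_distrib, Finset.sum_range_sub (fun j => φ (u + j • b) x),
    abs_div, abs_of_pos hn', div_le_iff₀ hn', mul_comm R]
  simpa using h u x

/-- Averaging along finitely many directions turns asymptotic Lipschitz bounds into Lipschitz
bounds, while keeping every property that is stable under averaging. -/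
theorem exists_lipschitz_of_asymptotic (r : U → ℝ) (D : Finset U) :
    ∀ C : (U → X → ℝ) → Prop,
      (∀ φ, C φ → ∀ n : ℕ, 0 < n → ∀ b, C (translateMean n b φ)) →
      ∀ φ, C φ → (∀ b ∈ D, ∃ n : ℕ, 0 < n ∧ ∀ u x, |φ (u + n • b) x - φ u x| ≤ n * r b) →
      ∃ ψ, C ψ ∧ ∀ b ∈ D, ∀ u x, |ψ (u + b) x - ψ u x| ≤ r b := by
  classical
  induction D using Finset.induction_on with
  | empty => exact fun C _ φ hφ _ => ⟨φ, hφ, by simp⟩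
  | insert b D _ ih =>
    intro C hC φ hφ h
    obtain ⟨n, hn, hb⟩ := h b (Finset.mem_insert_self b D)
    obtain ⟨ψ, ⟨hψ, hψb⟩, hψD⟩ := ih
      (fun ψ => C ψ ∧ ∀ u x, |ψ (u + n • b) x - ψ u x| ≤ n * r b)
      (fun ψ hψ k hk c => ⟨hC ψ hψ.1 k hk c, abs_translateMean_add_sub_le hψ.2 hk c⟩)
      φ ⟨hφ, hb⟩ (fun c hc => h c (Finset.mem_insert_of_mem hc))
    refine ⟨translateMean n b ψ, hC ψ hψ n hn b, fun c hc => ?_⟩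
    rcases Finset.mem_insert.1 hc with rfl | hc
    · exact abs_translateMean_add_self_sub_le hn hψb
    · exact abs_translateMean_add_sub_le (hψD c hc) hn b

end Averaging

section TranslationLength

variable {G X : Type*} [PseudoMetricSpace X] [Group G] [MulAction G X]

/-- The stable translation length of `g`, computed with the orbit of `x`. -/
noncomputable def translationLength (x : X) (g : G) : ℝ :=
  ⨅ n : ℕ, dist x (g ^ (n + 1) • x) / (n + 1 : ℕ)

theorem translationLength_mul_le (x : X) (g : G) (n : ℕ) :
    n * translationLength x g ≤ dist x (g ^ n • x) := by
  cases n with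
  | zero => simp
  | succ n =>
    have h : translationLength x g ≤ dist x (g ^ (n + 1) • x) / (n + 1 : ℕ) :=
      ciInf_le ⟨0, by rintro _ ⟨k, rfl⟩; positivity⟩ n
    rw [le_div_iff₀ (by positivity)] at h
    linarith

theorem exists_dist_pow_smul_lt (x : X) (g : G) {r : ℝ} (hr : translationLength x g < r) :
    ∃ n : ℕ, 0 < n ∧ dist x (g ^ n • x) < n * r := by
  obtain ⟨n, hn⟩ := exists_lt_of_ciInf_lt hr
  rw [div_lt_iff₀ (by positivity)] at hn
  exact ⟨n + 1, n.succ_pos, by linarith⟩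

theorem le_translationLength {x : X} {g : G} {r : ℝ}
    (h : ∀ n : ℕ, 0 < n → n * r ≤ dist x (g ^ n • x)) : r ≤ translationLength x g :=
  le_ciInf fun n => by
    rw [le_div_iff₀ (by positivity)]
    linarith [h (n + 1) n.succ_pos]

theorem translationLength_nonneg (x : X) (g : G) : 0 ≤ translationLength x g :=
  le_translationLength fun n _ => by simp

theorem translationLength_pow_le (x : X) (g : G) (n : ℕ) :
    n * translationLength x g ≤ translationLength x (g ^ n) :=
  le_translationLength fun k _ => by
    rw [← pow_mul]
    refine le_trans (le_of_eq ?_) (translationLength_mul_le x g _)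
    push_cast
    ring

variable [IsIsometricSMul G X]

theorem dist_pow_smul_le (x : X) (g : G) (n : ℕ) : dist x (g ^ n • x) ≤ n * dist x (g • x) := by
  induction n with
  | zero => simp
  | succ n ih =>
    have h1 := dist_triangle x (g ^ n • x) (g ^ (n + 1) • x)
    rw [pow_succ, mul_smul, dist_smul] at h1
    rw [pow_succ, mul_smul]
    push_cast
    linarith

theorem translationLength_le_dist (x y : X) (g : G) : translationLength x g ≤ dist y (g • y) := by
  by_contra! hlt
  obtain ⟨n, hn⟩ := exists_nat_gt (2 * dist x y / (translationLength x g - dist y (g • y)))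
  rw [div_lt_iff₀ (by linarith)] at hn
  have h1 := translationLength_mul_le x g n
  have h2 := dist_pow_smul_le y g n
  have h3 := dist_triangle4 x y (g ^ n • y) (g ^ n • x)
  rw [dist_smul, dist_comm y x] at h3
  linarith

theorem translationLength_conj_le (x : X) (g h : G) :
    translationLength x (h * g * h⁻¹) ≤ dist x (g • x) := by
  refine (translationLength_le_dist x (h • x) _).trans_eq ?_
  rw [← mul_smul, inv_mul_cancel_right, mul_smul, dist_smul]

theorem translationLength_one (x : X) : translationLength x (1 : G) = 0 :=
  le_antisymm (by simpa using translationLength_le_dist x x (1 : G)) (translationLength_nonneg _ _)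

theorem translationLength_inv_le (x : X) (g : G) :
    translationLength x g⁻¹ ≤ translationLength x g :=
  le_translationLength fun n _ => by
    refine (translationLength_mul_le x g⁻¹ n).trans_eq ?_
    rw [inv_pow, ← dist_smul (g ^ n), smul_inv_smul, dist_comm]

theorem Commute.translationLength_mul_le {g h : G} (hc : Commute g h) (x : X) :
    translationLength x (g * h) ≤ translationLength x g + translationLength x h := by
  refine le_of_forall_pos_le_add fun ε hε => ?_
  obtain ⟨m, hm, hgm⟩ := exists_dist_pow_smul_lt x g
    (show translationLength x g < translationLength x g + ε / 2 by linarith)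
  obtain ⟨n, hn, hhn⟩ := exists_dist_pow_smul_lt x h
    (show translationLength x h < translationLength x h + ε / 2 by linarith)
  have h1 := _root_.translationLength_mul_le x (g * h) (m * n)
  have h2 := dist_pow_smul_le x (g ^ m) n
  have h3 := dist_pow_smul_le x (h ^ n) m
  rw [← pow_mul] at h2 h3
  rw [hc.mul_pow, mul_smul] at h1
  have h4 := dist_triangle x (g ^ (m * n) • x) (g ^ (m * n) • h ^ (m * n) • x)
  rw [dist_smul] at h4
  rw [mul_comm n m] at h3
  have hm' : (0 : ℝ) < m := by exact_mod_cast hm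
  have hn' : (0 : ℝ) < n := by exact_mod_cast hn
  push_cast at h1
  have h5 := mul_le_mul_of_nonneg_left hgm.le hn'.le
  have h6 := mul_le_mul_of_nonneg_left hhn.le hm'.le
  refine le_of_mul_le_mul_left ?_ (mul_pos hm' hn')
  linarith

end TranslationLength

section CommGroupAction

variable {A X : Type*} [PseudoMetricSpace X] [CommGroup A] [MulAction A X] [IsIsometricSMul A X]

theorem translationLength_prod_le {ι : Type*} (x : X) (s : Finset ι) (f : ι → A) :
    translationLength x (∏ i ∈ s, f i) ≤ ∑ i ∈ s, translationLength x (f i) := by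
  classical
  induction s using Finset.induction_on with
  | empty => simp [translationLength_one]
  | insert i s hi ih =>
    rw [Finset.prod_insert hi, Finset.sum_insert hi]
    linarith [(Commute.all (f i) (∏ i ∈ s, f i)).translationLength_mul_le x]

theorem translationLength_pow_le_mul (x : X) (g : A) (n : ℕ) :
    translationLength x (g ^ n) ≤ n * translationLength x g := by
  simpa using translationLength_prod_le x (Finset.range n) (fun _ => g)

theorem translationLength_div_le (x : X) (g h : A) :
    translationLength x (g / h) ≤ translationLength x g + translationLength x h := by
  rw [div_eq_mul_inv]
  linarith [(Commute.all g h⁻¹).translationLength_mul_le x, translationLength_inv_le x h]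

/-- The element of `A` with exponents `w` in terms of the family `a`. -/
def zpowProd {ι : Type*} [Fintype ι] (a : ι → A) (w : ι → ℤ) : A := ∏ i, a i ^ w i

theorem zpowProd_add {ι : Type*} [Fintype ι] (a : ι → A) (v w : ι → ℤ) :
    zpowProd a (v + w) = zpowProd a v * zpowProd a w := by
  simp only [zpowProd, Pi.add_apply, zpow_add, Finset.prod_mul_distrib]

theorem zpowProd_nsmul {ι : Type*} [Fintype ι] (a : ι → A) (n : ℕ) (w : ι → ℤ) :
    zpowProd a (n • w) = zpowProd a w ^ n := by
  simp only [zpowProd, Pi.smul_apply, ← Finset.prod_pow]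
  exact Finset.prod_congr rfl fun i _ => by rw [nsmul_eq_mul, mul_comm, zpow_mul, zpow_natCast]

theorem zpowProd_single {ι : Type*} [Fintype ι] [DecidableEq ι] (a : ι → A) (i : ι) (n : ℤ) :
    zpowProd a (Pi.single i n) = a i ^ n := by
  unfold zpowProd
  rw [Finset.prod_eq_single i] <;> simp +contextual [Pi.single_eq_of_ne]

/-- A finitely generated free abelian group mapping to `A`, refined by a factor `m`, maps
equivariantly to the injective hull of `X`, without increasing the stable translation length,
up to small errors and for finitely many differences. -/
theorem exists_equivariant_lipschitz_isExtremal (x₀ : X) {ι : Type*} [Fintype ι] (a : ι → A)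
    {m : ℕ} (hm : 0 < m) (D : Finset (ι → ℤ)) :
    ∃ P : (ι → ℤ) → X → ℝ, (∀ u, IsExtremal (P u)) ∧
      (∀ u w x, P (u + m • w) (zpowProd a w • x) = P u x) ∧
      ∀ b ∈ D, ∀ u x, |P (u + b) x - P u x| ≤ (translationLength x₀ (zpowProd a b) + 1) / m := by
  have hm' : (0 : ℝ) < m := by exact_mod_cast hm
  obtain ⟨ψ, ⟨hmaj, hequiv⟩, hlip⟩ := exists_lipschitz_of_asymptotic
    (X := X) (fun b => (translationLength x₀ (zpowProd a b) + 1) / m) D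
    (fun φ => (∀ u, IsMajorant (φ u)) ∧ ∀ u w x, φ (u + m • w) (zpowProd a w • x) = φ u x)
    (fun φ hφ n hn b => by
      have hn' : (0 : ℝ) < n := by exact_mod_cast hn
      refine ⟨fun u x y => ?_, fun u w x => ?_⟩
      · unfold translateMean
        rw [← add_div, le_div_iff₀ hn', ← Finset.sum_add_distrib]
        calc dist x y * n = ∑ j ∈ Finset.range n, dist x y := by simp [mul_comm]
          _ ≤ _ := Finset.sum_le_sum fun j _ => hφ.1 _ x y
      · unfold translateMean
        simp only [add_right_comm u (m • w), hφ.2])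
    (fun u x => dist (zpowProd a (fun i => u i / m) • x₀) x)
    (by
      refine ⟨fun u x y => dist_triangle_left _ _ _, fun u w x => ?_⟩
      have : (fun i => (u + m • w) i / (m : ℤ)) = w + fun i => u i / (m : ℤ) := by
        funext i
        simp only [Pi.add_apply, Pi.smul_apply]
        rw [nsmul_eq_mul, Int.add_mul_ediv_left _ _ (by exact_mod_cast hm.ne'), add_comm]
      simp only [this]
      rw [zpowProd_add, mul_smul, dist_smul])
    (fun b _ => by
      obtain ⟨n, hn, hlt⟩ := exists_dist_pow_smul_lt x₀ (zpowProd a b)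
        (show translationLength x₀ (zpowProd a b) < translationLength x₀ (zpowProd a b) + 1 by
          linarith)
      refine ⟨m * n, Nat.mul_pos hm hn, fun u x => ?_⟩
      have : (fun i => (u + (m * n) • b) i / (m : ℤ)) = (fun i => u i / (m : ℤ)) + n • b := by
        funext i
        simp only [Pi.add_apply, Pi.smul_apply]
        rw [nsmul_eq_mul, nsmul_eq_mul, Nat.cast_mul, mul_assoc, Int.add_mul_ediv_left _ _ (by exact_mod_cast hm.ne')]
      simp only [this]
      rw [zpowProd_add, zpowProd_nsmul, mul_smul]
      refine (abs_dist_sub_le _ _ _).trans ?_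
      rw [dist_smul, dist_comm]
      refine hlt.le.trans_eq ?_
      push_cast
      field_simp)
  refine ⟨fun u => extremalRetraction (ψ u), fun u => (hmaj u).isExtremal_extremalRetraction,
    fun u w x => ?_, fun b hb u x => abs_extremalRetraction_sub_le (hmaj _) (hmaj _) (hlip b hb u) x⟩
  have h := extremalRetraction_comp (IsometryEquiv.constSMul (zpowProd a w)) (ψ (u + m • w))
  have h' : ψ (u + m • w) ∘ (IsometryEquiv.constSMul (zpowProd a w) : X ≃ᵢ X) = ψ u :=
    funext fun x => hequiv u w x
  rw [h'] at h
  exact (congrFun h x).symm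

/-- Finitely many elements of bounded translation length have bounded displacement at a
common point. -/
theorem exists_dist_smul_le (hX : IsCoarselyInjective X) (x₀ : X) {ι : Type*} [Fintype ι]
    (a : ι → A) : ∃ w : X, ∀ i, dist w (a i • w) ≤ translationLength x₀ (a i) + 3 := by
  classical
  obtain ⟨P, hext, hequiv, hlip⟩ := exists_equivariant_lipschitz_isExtremal x₀ a one_pos
    (Finset.univ.image fun i => Pi.single i (1 : ℤ))
  obtain ⟨w, hw⟩ := hX.exists_abs_sub_dist_le (hext 0)
  refine ⟨w, fun i => ?_⟩
  have h1 := hlip (Pi.single i 1) (Finset.mem_image_of_mem _ (Finset.mem_univ i)) 0 (a i • w)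
  have h2 := hequiv 0 (Pi.single i 1) w
  simp only [zpowProd_single, one_smul, zpow_one, Nat.cast_one, div_one] at h1 h2
  rw [h2] at h1
  have h3 := hw w
  have h4 := hw (a i • w)
  rw [dist_self] at h3
  linarith [(abs_le.1 h1).1, (abs_le.1 h3).2, (abs_le.1 h4).1]

/-- Families of elements of `A` separated at scale `m` yield separated families of points of `X`
at a fixed scale. -/
theorem exists_separated_points (hX : IsCoarselyInjective X) (x₀ : X) {ι : Type*} [Fintype ι]
    (a : ι → A) {m : ℕ} (hm : 0 < m)
    (hlow : ∀ i j, i ≠ j → 10 * m < translationLength x₀ (a i / a j))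
    (hupp : ∀ i j, translationLength x₀ (a i / a j) ≤ 40 * m) :
    ∃ w : ι → X, Function.Injective w ∧ ∀ i j, dist (w i) (w j) ≤ 43 := by
  classical
  have hm' : (0 : ℝ) < m := by exact_mod_cast hm
  have hm1 : (1 : ℝ) ≤ m := by exact_mod_cast hm
  let e : ι → ι → ℤ := fun i => Pi.single i 1
  obtain ⟨P, hext, hequiv, hlip⟩ := exists_equivariant_lipschitz_isExtremal x₀ a hm
    (Finset.univ.image fun p : ι × ι => e p.1 - e p.2)
  have hprod : ∀ i j, zpowProd a (e i - e j) = a i / a j := fun i j => by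
    have := zpowProd_add a (e i - e j) (e j)
    rw [sub_add_cancel, zpowProd_single, zpowProd_single, zpow_one, zpow_one] at this
    rw [this, mul_div_cancel_right]
  have hlip' : ∀ i j u x, |P (u + (e i - e j)) x - P u x| ≤
      (translationLength x₀ (a i / a j) + 1) / m := fun i j u x => by
    rw [← hprod]
    exact hlip _ (Finset.mem_image_of_mem (fun p : ι × ι => e p.1 - e p.2)
      (Finset.mem_univ (i, j))) u x
  choose w hw using fun i => hX.exists_abs_sub_dist_le (hext (e i))
  refine ⟨w, fun i j hij => ?_, fun i j => ?_⟩
  · by_contra hne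
    set t := translationLength x₀ (a i / a j) with ht
    have hclose : ∀ x, |P (e j + (e i - e j)) x - P (e j) x| ≤ 2 := fun x => by
      rw [add_sub_cancel]
      have h1 := abs_le.1 (hw i x)
      have h2 := abs_le.1 (hw j x)
      rw [hij] at h1
      rw [abs_le]
      constructor <;> linarith
    have hchain : ∀ n : ℕ, ∀ x, |P (e j + (n + 1) • (e i - e j)) x - P (e j) x| ≤
        2 + n * ((t + 1) / m) := by
      intro n x
      induction n with
      | zero => simpa using hclose x
      | succ n ih =>
        have h := hlip' i j (e j + (n + 1) • (e i - e j)) x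
        rw [add_assoc, ← succ_nsmul] at h
        have := abs_sub_le (P (e j + (n + 1 + 1) • (e i - e j)) x)
          (P (e j + (n + 1) • (e i - e j)) x) (P (e j) x)
        push_cast
        linarith
    obtain ⟨k, rfl⟩ : ∃ k, m = k + 1 := ⟨m - 1, by omega⟩
    have h1 := hchain k ((a i / a j) • w j)
    have h2 := hequiv (e j) (e i - e j) (w j)
    rw [hprod] at h2
    rw [h2] at h1
    have h3 := abs_le.1 (hw j (w j))
    have h4 := abs_le.1 (hw j ((a i / a j) • w j))
    rw [dist_self] at h3
    have h5 := translationLength_le_dist x₀ (w j) (a i / a j)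
    rw [← ht] at h5
    have h6 := (abs_le.1 h1).1
    have h7 := hlow i j hne
    rw [← ht] at h7
    push_cast at *
    have h8 : (k : ℝ) * ((t + 1) / (k + 1)) = (t + 1) - (t + 1) / (k + 1) := by
      field_simp
      ring
    have h9 : (10 : ℝ) ≤ (t + 1) / (k + 1) := by
      rw [le_div_iff₀ (by positivity)]
      linarith
    linarith
  · have h1 := hlip' i j (e j) (w j)
    rw [add_sub_cancel] at h1
    have h2 := abs_le.1 (hw i (w j))
    have h3 := abs_le.1 (hw j (w j))
    rw [dist_self] at h3
    have h4 : (translationLength x₀ (a i / a j) + 1) / m ≤ 41 := by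
      rw [div_le_iff₀ hm']
      linarith [hupp i j]
    linarith [(abs_le.1 h1).2]

end CommGroupAction

section FinitelyGenerated

variable {A X : Type*} [PseudoMetricSpace X] [CommGroup A] [MulAction A X]

/-- The action is proper, uniformly over all basepoints. -/
def IsUniformlyProperAction (G X : Type*) [PseudoMetricSpace X] [Group G] [MulAction G X] : Prop :=
  ∀ R : ℝ, ∃ N : ℕ, ∀ x : X, ∀ T : Finset G, (∀ g ∈ T, dist x (g • x) ≤ R) → T.card ≤ N

/-- Balls of a given radius have boundedly many points. -/
def HasBoundedGeometry (X : Type*) [PseudoMetricSpace X] : Prop :=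
  ∀ R : ℝ, ∃ N : ℕ, ∀ x : X, ∀ T : Finset X, (∀ y ∈ T, dist x y ≤ R) → T.card ≤ N

variable [IsIsometricSMul A X]

theorem finite_translationLength_le (hX : IsCoarselyInjective X) (hA : IsUniformlyProperAction A X)
    (x₀ : X) (r : ℝ) : {g : A | translationLength x₀ g ≤ r}.Finite := by
  by_contra hinf
  obtain ⟨N, hN⟩ := hA (r + 3)
  obtain ⟨T, hT, hcard⟩ := Set.Infinite.exists_subset_card_eq hinf (N + 1)
  obtain ⟨w, hw⟩ := exists_dist_smul_le hX x₀ (fun g : T => (g : A))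
  have := hN w T fun g hg => (hw ⟨g, hg⟩).trans (add_le_add_left (hT hg) 3)
  omega

theorem exists_card_separated_le (hX : IsCoarselyInjective X) (hb : HasBoundedGeometry X)
    (x₀ : X) : ∃ K : ℕ, 0 < K ∧ ∀ m : ℕ, 0 < m → ∀ S : Finset A,
      (∀ s ∈ S, ∀ t ∈ S, s ≠ t → 10 * m < translationLength x₀ (s / t)) →
      (∀ s ∈ S, ∀ t ∈ S, translationLength x₀ (s / t) ≤ 40 * m) → S.card ≤ K := by
  classical
  obtain ⟨N, hN⟩ := hb 43
  refine ⟨N + 1, N.succ_pos, fun m hm S hlow hupp => ?_⟩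
  obtain ⟨w, hinj, hw⟩ := exists_separated_points hX x₀ (fun s : S => (s : A)) hm
    (fun s t hst => hlow s s.2 t t.2 (Subtype.coe_ne_coe.2 hst)) (fun s t => hupp s s.2 t t.2)
  rcases S.eq_empty_or_nonempty with rfl | ⟨s, hs⟩
  · simp
  · have := hN (w ⟨s, hs⟩) (Finset.univ.image w) (fun y hy => by
      obtain ⟨t, -, rfl⟩ := Finset.mem_image.1 hy
      exact hw _ t)
    rw [Finset.card_image_of_injective _ hinj, Finset.card_univ, Fintype.card_coe] at this
    omega

theorem exists_doubling (hX : IsCoarselyInjective X) (hA : IsUniformlyProperAction A X)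
    (hb : HasBoundedGeometry X) (x₀ : X) : ∃ K : ℕ, 0 < K ∧ ∀ m : ℕ, 0 < m →
      {g : A | translationLength x₀ g ≤ 20 * m}.ncard ≤
        K * {g : A | translationLength x₀ g ≤ 10 * m}.ncard := by
  classical
  obtain ⟨K, hK0, hK⟩ := exists_card_separated_le (A := A) hX hb x₀
  refine ⟨K, hK0, fun m hm => ?_⟩
  have h20 := finite_translationLength_le hX hA x₀ (20 * m)
  have h10 := finite_translationLength_le hX hA x₀ (10 * m)
  rw [Set.ncard_eq_toFinset_card _ h20, Set.ncard_eq_toFinset_card _ h10]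
  obtain ⟨S, hS, hmax⟩ := Finset.exists_max_image
    (h20.toFinset.powerset.filter fun S => ∀ s ∈ S, ∀ t ∈ S, s ≠ t →
      10 * m < translationLength x₀ (s / t)) Finset.card ⟨∅, by simp⟩
  simp only [Finset.mem_filter, Finset.mem_powerset] at hS hmax
  have hS20 : ∀ s ∈ S, translationLength x₀ s ≤ 20 * m := fun s hs => by
    simpa using hS.1 hs
  have hsymm : ∀ s t : A, translationLength x₀ (s / t) ≤ translationLength x₀ (t / s) :=
    fun s t => by simpa using translationLength_inv_le x₀ (t / s)
  have hcover : h20.toFinset ⊆ S.biUnion fun t => h10.toFinset.image (· * t) := by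
    intro g hg
    rw [Finset.mem_biUnion]
    by_contra! hfar
    have hfar' : ∀ t ∈ S, 10 * m < translationLength x₀ (g / t) := fun t ht => by
      by_contra! hle
      exact hfar t ht (Finset.mem_image.2 ⟨g / t, by simpa using hle, div_mul_cancel g t⟩)
    have hgS : g ∉ S := fun hgS => by
      have := hfar' g hgS
      rw [div_self', translationLength_one] at this
      have : (0 : ℝ) ≤ m := m.cast_nonneg
      linarith
    have := hmax (insert g S) ⟨Finset.insert_subset hg hS.1, fun s hs t ht hst => by
      rcases Finset.mem_insert.1 hs with rfl | hs' <;> rcases Finset.mem_insert.1 ht with rfl | ht'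
      · exact absurd rfl hst
      · exact hfar' t ht'
      · exact (hfar' s hs').trans_le (hsymm _ _)
      · exact hS.2 s hs' t ht' hst⟩
    rw [Finset.card_insert_of_notMem hgS] at this
    omega
  refine (Finset.card_le_card hcover).trans <| (Finset.card_biUnion_le_card_mul _ _ _
    fun t _ => Finset.card_image_le).trans (Nat.mul_le_mul_right _ (hK m hm S hS.2 ?_))
  intro s hs t ht
  linarith [translationLength_div_le x₀ s t, hS20 s hs, hS20 t ht]

/-- The rank of free abelian subgroups of `A` is bounded. -/
theorem exists_rank_le (hX : IsCoarselyInjective X) (hA : IsUniformlyProperAction A X)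
    (hb : HasBoundedGeometry X) (x₀ : X) :
    ∃ K : ℕ, ∀ k : ℕ, ∀ a : Fin k → A, Function.Injective (zpowProd a) → k ≤ K := by
  obtain ⟨K, hK0, hK⟩ := exists_doubling hX hA hb x₀
  refine ⟨K, fun k a ha => ?_⟩
  obtain ⟨c, hc⟩ := exists_nat_gt (∑ i, translationLength x₀ (a i))
  have hc0 : 0 < c := by
    have : (0 : ℝ) ≤ ∑ i, translationLength x₀ (a i) :=
      Finset.sum_nonneg fun i _ => translationLength_nonneg _ _
    exact_mod_cast this.trans_lt hc
  set n₀ := {g : A | translationLength x₀ g ≤ 10 * c}.ncard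
  have hupp : ∀ j : ℕ,
      {g : A | translationLength x₀ g ≤ 10 * (2 ^ j * c : ℕ)}.ncard ≤ K ^ j * n₀ := by
    intro j
    induction j with
    | zero => simp [n₀]
    | succ j ih =>
      have h := hK (2 ^ j * c) (by positivity)
      have heq : (10 : ℝ) * (2 ^ (j + 1) * c : ℕ) = 20 * (2 ^ j * c : ℕ) := by
        push_cast; ring
      rw [heq, pow_succ, mul_comm (K ^ j), mul_assoc]
      exact h.trans (Nat.mul_le_mul_left _ ih)
  have hlow : ∀ j : ℕ,
      (2 ^ j) ^ k ≤ {g : A | translationLength x₀ g ≤ 10 * (2 ^ j * c : ℕ)}.ncard := by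
    intro j
    have hfin := finite_translationLength_le (A := A) hX hA x₀ (10 * (2 ^ j * c : ℕ))
    have hinj : Function.Injective fun e : Fin k → Fin (2 ^ j) =>
        zpowProd a fun i => ((e i : ℕ) : ℤ) := fun e e' h => by
      have := ha h
      funext i
      have := congrFun this i
      simpa [Fin.ext_iff] using this
    calc (2 ^ j) ^ k = (Set.univ : Set (Fin k → Fin (2 ^ j))).ncard := by
          simp [Set.ncard_univ, Nat.card_eq_fintype_card]
      _ = ((fun e : Fin k → Fin (2 ^ j) => zpowProd a fun i => ((e i : ℕ) : ℤ)) ''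
          Set.univ).ncard := (Set.ncard_image_of_injective _ hinj).symm
      _ ≤ _ := by
        refine Set.ncard_le_ncard ?_ hfin
        rintro _ ⟨e, -, rfl⟩
        simp only [Set.mem_ofPred_eq, zpowProd, zpow_natCast]
        calc translationLength x₀ (∏ i, a i ^ (e i : ℕ))
            ≤ ∑ i, translationLength x₀ (a i ^ (e i : ℕ)) := translationLength_prod_le _ _ _
          _ ≤ ∑ i, 2 ^ j * translationLength x₀ (a i) := Finset.sum_le_sum fun i _ =>
              (translationLength_pow_le_mul _ _ _).trans <| mul_le_mul_of_nonneg_right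
                (by exact_mod_cast (e i).2.le) (translationLength_nonneg _ _)
          _ ≤ 10 * (2 ^ j * c : ℕ) := by
              rw [← Finset.mul_sum]
              have h1 := mul_le_mul_of_nonneg_left hc.le (by positivity : (0 : ℝ) ≤ 2 ^ j)
              have h2 : (0 : ℝ) ≤ 2 ^ j * c := by positivity
              push_cast
              linarith
  by_contra! hlt
  have hK2 : K + 1 ≤ 2 ^ k := Nat.succ_le_of_lt (hlt.trans k.lt_two_pow_self)
  have hKr : (0 : ℝ) < K := by exact_mod_cast hK0
  obtain ⟨j, hj⟩ := pow_unbounded_of_one_lt (n₀ : ℝ)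
    (show (1 : ℝ) < (K + 1) / K by rw [lt_div_iff₀ hKr]; linarith)
  rw [div_pow, lt_div_iff₀ (by positivity)] at hj
  have h1 : (K + 1) ^ j ≤ K ^ j * n₀ := by
    calc (K + 1) ^ j ≤ (2 ^ k) ^ j := Nat.pow_le_pow_left hK2 j
      _ = (2 ^ j) ^ k := by rw [← pow_mul, ← pow_mul, mul_comm]
      _ ≤ _ := (hlow j).trans (hupp j)
  have h2 : ((K : ℝ) + 1) ^ j ≤ K ^ j * n₀ := by exact_mod_cast h1
  linarith

theorem exists_pow_eq_zpowProd {k : ℕ} {a : Fin k → A} (ha : Function.Injective (zpowProd a))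
    (hmax : ∀ b : Fin (k + 1) → A, ¬ Function.Injective (zpowProd b)) (g : A) :
    ∃ m : ℕ, 0 < m ∧ ∃ w, g ^ m = zpowProd a w := by
  have hcons : ∀ v : Fin (k + 1) → ℤ,
      zpowProd (Fin.cons g a : Fin (k + 1) → A) v = g ^ v 0 * zpowProd a (fun i => v i.succ) :=
    fun v => by simp [zpowProd, Fin.prod_univ_succ]
  have h := hmax (Fin.cons g a)
  simp only [Function.Injective, not_forall] at h
  obtain ⟨u, v, huv, hne⟩ := h
  rw [hcons, hcons] at huv
  have key : g ^ (u 0 - v 0) = zpowProd a (fun i => v i.succ - u i.succ) := by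
    have h1 := zpowProd_add a (fun i => v i.succ - u i.succ) (fun i => u i.succ)
    have h2 : (fun i : Fin k => v i.succ - u i.succ) + (fun i => u i.succ) = fun i => v i.succ := by
      funext i; simp
    rw [h2] at h1
    rw [zpow_sub, mul_inv_eq_iff_eq_mul]
    refine mul_right_cancel (b := zpowProd a fun i => u i.succ) ?_
    rw [huv, h1, mul_assoc]
    exact mul_left_comm _ _ _
  have h0 : u 0 - v 0 ≠ 0 := fun h0 => hne <| by
    rw [h0, zpow_zero] at key
    have h1 := ha (key.symm.trans (show (1 : A) = zpowProd a 0 by simp [zpowProd]))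
    funext i
    refine Fin.cases (by linarith) (fun i => ?_) i
    have := congrFun h1 i
    simp only [Pi.zero_apply] at this
    linarith
  have hneg : ∀ w : Fin k → ℤ, (zpowProd a w)⁻¹ = zpowProd a (-w) := fun w => by
    rw [inv_eq_iff_mul_eq_one, ← zpowProd_add]
    simp [zpowProd]
  refine ⟨(u 0 - v 0).natAbs, Int.natAbs_pos.2 h0, ?_⟩
  rcases Int.natAbs_eq (u 0 - v 0) with h | h
  · refine ⟨fun i => v i.succ - u i.succ, ?_⟩
    rw [← zpow_natCast, ← h, key]
  · refine ⟨-fun i => v i.succ - u i.succ, ?_⟩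
    rw [← zpow_natCast, ← neg_neg (((u 0 - v 0).natAbs : ℕ) : ℤ), ← h, zpow_neg, key, hneg]

/-- An abelian group acting uniformly properly on a coarsely injective space of bounded geometry
is finitely generated. -/
theorem CommGroup.fg_of_isUniformlyProperAction (hX : IsCoarselyInjective X)
    (hA : IsUniformlyProperAction A X) (hb : HasBoundedGeometry X) (x₀ : X) : Group.FG A := by
  classical
  obtain ⟨K, hK⟩ := exists_rank_le hX hA hb x₀
  let Q : ℕ → Prop := fun k => ∃ a : Fin k → A, Function.Injective (zpowProd a)
  have hQ0 : Q 0 := ⟨Fin.elim0, fun _ _ _ => Subsingleton.elim _ _⟩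
  obtain ⟨a, ha⟩ : Q (Nat.findGreatest Q K) := Nat.findGreatest_spec (Nat.zero_le K) hQ0
  have hmax : ∀ b : Fin (Nat.findGreatest Q K + 1) → A, ¬ Function.Injective (zpowProd b) :=
    fun b hb => by
      have := Nat.le_findGreatest (P := Q) (hK _ b hb) ⟨b, hb⟩
      omega
  set c := ∑ i, translationLength x₀ (a i)
  have hfin := finite_translationLength_le (A := A) hX hA x₀ c
  refine ⟨⟨hfin.toFinset ∪ Finset.univ.image a, ?_⟩⟩
  rw [eq_top_iff]
  intro g _
  set L := Subgroup.closure (↑(hfin.toFinset ∪ Finset.univ.image a) : Set A)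
  have hL : ∀ w, zpowProd a w ∈ L := fun w => Subgroup.prod_mem _ fun i _ =>
    Subgroup.zpow_mem _ (Subgroup.subset_closure (by simp)) _
  obtain ⟨m, hm, w, hw⟩ := exists_pow_eq_zpowProd ha hmax g
  have hm' : (0 : ℝ) < m := by exact_mod_cast hm
  have hmz : (m : ℤ) ≠ 0 := by exact_mod_cast hm.ne'
  let q : Fin (Nat.findGreatest Q K) → ℤ := fun i => w i / m
  let r : Fin (Nat.findGreatest Q K) → ℕ := fun i => (w i % m).toNat
  have hr : ∀ i, ((r i : ℕ) : ℤ) = w i % m := fun i => Int.toNat_of_nonneg (Int.emod_nonneg _ hmz)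
  have hrm : ∀ i, r i ≤ m := fun i => by
    have := Int.emod_lt_of_pos (w i) (show (0 : ℤ) < m by exact_mod_cast hm)
    rw [← hr] at this
    exact_mod_cast this.le
  have hpow : (g / zpowProd a q) ^ m = ∏ i, a i ^ r i := by
    have h1 : w = (fun i => (r i : ℤ)) + m • q := by
      funext i
      simp only [Pi.add_apply, Pi.smul_apply, hr, q]
      rw [nsmul_eq_mul, Int.emod_add_mul_ediv]
    rw [div_pow, hw, ← zpowProd_nsmul, div_eq_iff_eq_mul]
    conv_lhs => rw [h1]
    rw [zpowProd_add]
    simp [zpowProd]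
  have hsmall : translationLength x₀ (g / zpowProd a q) ≤ c := by
    have h1 := translationLength_pow_le x₀ (g / zpowProd a q) m
    rw [hpow] at h1
    refine le_of_mul_le_mul_left (h1.trans ?_) hm'
    calc translationLength x₀ (∏ i, a i ^ r i)
        ≤ ∑ i, translationLength x₀ (a i ^ r i) := translationLength_prod_le _ _ _
      _ ≤ ∑ i, m * translationLength x₀ (a i) := Finset.sum_le_sum fun i _ =>
          (translationLength_pow_le_mul _ _ _).trans <| mul_le_mul_of_nonneg_right
            (by exact_mod_cast hrm i) (translationLength_nonneg _ _)
      _ = m * c := by rw [← Finset.mul_sum]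
  have hmem : g / zpowProd a q ∈ L := Subgroup.subset_closure (by simp [hsmall])
  simpa using L.mul_mem hmem (hL q)

end FinitelyGenerated

section SolubleGroups

open scoped commutatorElement

/-- Every abelian subgroup is finitely generated and meets each conjugacy class of its elements
in a finite set. -/
def HasTameAbelianSubgroups (G : Type*) [Group G] : Prop :=
  ∀ A : Subgroup G, (∀ a ∈ A, ∀ b ∈ A, a * b = b * a) →
    A.FG ∧ ∀ a ∈ A, {b | b ∈ A ∧ IsConj a b}.Finite

/-- Some abelian subgroup has finite index. -/
def IsVirtuallyAbelian (G : Type*) [Group G] : Prop :=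
  ∃ K : Subgroup G, K.FiniteIndex ∧ ∀ a b : K, a * b = b * a

variable {G : Type*} [Group G]

theorem HasTameAbelianSubgroups.subgroup (hG : HasTameAbelianSubgroups G) (H : Subgroup G) :
    HasTameAbelianSubgroups H := by
  intro A hA
  obtain ⟨hfg, hconj⟩ := hG (A.map H.subtype) (by
    rintro _ ⟨a, ha, rfl⟩ _ ⟨b, hb, rfl⟩
    exact congrArg H.subtype (hA a ha b hb))
  refine ⟨?_, fun a ha => ?_⟩
  · rw [← Group.fg_iff_subgroup_fg] at hfg ⊢
    exact Group.fg_of_surjective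
      (f := (A.equivMapOfInjective _ H.subtype_injective).symm.toMonoidHom)
      (MulEquiv.surjective _)
  · refine Set.Finite.of_finite_image ((hconj a ⟨a, ha, rfl⟩).subset ?_)
      (H.subtype_injective.injOn)
    rintro _ ⟨b, ⟨hb, hab⟩, rfl⟩
    exact ⟨⟨b, hb, rfl⟩, H.subtype.map_isConj hab⟩

theorem IsVirtuallyAbelian.of_subgroup {H : Subgroup G} [H.FiniteIndex]
    (hH : IsVirtuallyAbelian H) : IsVirtuallyAbelian G := by
  obtain ⟨K, hK, hcomm⟩ := hH
  refine ⟨K.map H.subtype, ⟨?_⟩, ?_⟩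
  · rw [Subgroup.index_map_subtype]
    exact mul_ne_zero hK.index_ne_zero Subgroup.FiniteIndex.index_ne_zero
  · rintro ⟨_, a, ha, rfl⟩ ⟨_, b, hb, rfl⟩
    have := congrArg (fun x : K => ((x : H) : G)) (hcomm ⟨a, ha⟩ ⟨b, hb⟩)
    exact Subtype.ext this

theorem finiteIndex_centralizer_singleton {g : G} (hg : {b | IsConj g b}.Finite) :
    (Subgroup.centralizer {g}).FiniteIndex := by
  have := hg.to_subtype
  let f : G ⧸ Subgroup.centralizer {g} → {b | IsConj g b} := Quotient.lift
    (fun h : G => ⟨h * g * h⁻¹, isConj_iff.2 ⟨h, rfl⟩⟩) (fun h k hk => by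
      have hk := Subgroup.mem_centralizer_singleton_iff.1 (QuotientGroup.leftRel_apply.1 hk)
      refine Subtype.ext ?_
      calc h * g * h⁻¹ = h * (g * (h⁻¹ * k)) * k⁻¹ := by group
        _ = h * ((h⁻¹ * k) * g) * k⁻¹ := by rw [hk]
        _ = k * g * k⁻¹ := by group)
  have hf : Function.Injective f := by
    intro x y
    induction x using QuotientGroup.induction_on with | H h => ?_
    induction y using QuotientGroup.induction_on with | H k => ?_
    intro h'
    have h' : h * g * h⁻¹ = k * g * k⁻¹ := congrArg Subtype.val h'
    rw [QuotientGroup.eq, Subgroup.mem_centralizer_singleton_iff]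
    calc h⁻¹ * k * g = h⁻¹ * (k * g * k⁻¹) * k := by group
      _ = h⁻¹ * (h * g * h⁻¹) * k := by rw [h']
      _ = g * (h⁻¹ * k) := by group
  have := Finite.of_injective f hf
  exact Subgroup.finiteIndex_of_finite_quotient

theorem finiteIndex_centralizer {S : Set G} (hS : S.Finite)
    (hconj : ∀ g ∈ S, {b | IsConj g b}.Finite) : (Subgroup.centralizer S).FiniteIndex := by
  have := Subgroup.finiteIndex_iInf' (s := hS.toFinset) (fun g => Subgroup.centralizer {g})
    (fun g hg => finiteIndex_centralizer_singleton (hconj g (by simpa using hg)))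
  refine Subgroup.finiteIndex_of_le (H := ⨅ g ∈ hS.toFinset, Subgroup.centralizer {g})
    fun h hh => ?_
  rw [Subgroup.mem_centralizer_iff]
  intro g hg
  simp only [Subgroup.mem_iInf, Set.Finite.mem_toFinset] at hh
  exact (Subgroup.mem_centralizer_singleton_iff.1 (hh g hg)).symm

theorem HasTameAbelianSubgroups.finiteIndex_centralizer (hG : HasTameAbelianSubgroups G)
    {A : Subgroup G} [A.Normal] (hA : ∀ a ∈ A, ∀ b ∈ A, a * b = b * a) :
    (Subgroup.centralizer (A : Set G)).FiniteIndex := by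
  obtain ⟨⟨S, rfl⟩, hconj⟩ := hG A hA
  rw [Subgroup.centralizer_closure]
  refine _root_.finiteIndex_centralizer S.finite_toSet fun g hg => ?_
  have hg' := Subgroup.subset_closure hg
  refine (hconj g hg').subset fun b hb => ⟨?_, hb⟩
  obtain ⟨c, rfl⟩ := isConj_iff.1 hb
  exact Subgroup.Normal.conj_mem inferInstance g hg' c

theorem exists_maximal_normal_abelian (G : Type*) [Group G] :
    ∃ M : Subgroup G, Maximal (· ∈ {M : Subgroup G | M.Normal ∧ ∀ a ∈ M, ∀ b ∈ M, a * b = b * a})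
      M := by
  obtain ⟨M, -, hM⟩ := zorn_le_nonempty₀
    {M : Subgroup G | M.Normal ∧ ∀ a ∈ M, ∀ b ∈ M, a * b = b * a} (by
      intro c hc hchain y hy
      have hmem : ∀ x, x ∈ sSup c ↔ ∃ K ∈ c, x ∈ K := fun x =>
        Subgroup.mem_sSup_of_directedOn ⟨y, hy⟩ hchain.directedOn
      refine ⟨sSup c, ⟨⟨fun n hn g => ?_⟩, fun a ha b hb => ?_⟩, fun K hK => le_sSup hK⟩
      · obtain ⟨K, hK, hnK⟩ := (hmem n).1 hn
        exact (hmem _).2 ⟨K, hK, (hc hK).1.conj_mem n hnK g⟩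
      · obtain ⟨K, hK, haK⟩ := (hmem a).1 ha
        obtain ⟨L, hL, hbL⟩ := (hmem b).1 hb
        rcases hchain.total hK hL with h | h
        · exact (hc hL).2 a (h haK) b hbL
        · exact (hc hK).2 a haK b (h hbL))
    ⊥ ⟨inferInstance, fun a ha b hb => by
      rw [Subgroup.mem_bot.1 ha, Subgroup.mem_bot.1 hb]⟩
  exact ⟨M, hM⟩

/-- In a nilpotent group, a maximal abelian normal subgroup is its own centralizer. -/
theorem centralizer_le_of_maximal [Group.IsNilpotent G] {M : Subgroup G}
    (hM : Maximal (· ∈ {M : Subgroup G | M.Normal ∧ ∀ a ∈ M, ∀ b ∈ M, a * b = b * a}) M) :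
    Subgroup.centralizer (M : Set G) ≤ M := by
  have hnormal : M.Normal := hM.prop.1
  have key : ∀ n : ℕ, ∀ x ∈ Subgroup.upperCentralSeries G n,
      x ∈ Subgroup.centralizer (M : Set G) → x ∈ M := by
    intro n
    induction n with
    | zero =>
      intro x hx _
      rw [Subgroup.upperCentralSeries_zero, Subgroup.mem_bot] at hx
      rw [hx]
      exact M.one_mem
    | succ n ih =>
      intro x hx hxM
      have hcomm : ∀ y, ⁅x, y⁆ ∈ M := fun y => by
        refine ih _ (Subgroup.mem_upperCentralSeries_succ_iff.1 hx y) ?_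
        rw [commutatorElement_def, mul_assoc, mul_assoc, ← mul_assoc y]
        exact mul_mem hxM (Subgroup.Normal.conj_mem inferInstance _ (inv_mem hxM) y)
      have hgen : ∀ a ∈ (M : Set G) ∪ {x}, ∀ b ∈ (M : Set G) ∪ {x}, a * b = b * a := by
        rintro a (ha | rfl) b (hb | rfl)
        · exact hM.prop.2 a ha b hb
        · exact Subgroup.mem_centralizer_iff.1 hxM a ha
        · exact (Subgroup.mem_centralizer_iff.1 hxM b hb).symm
        · rfl
      set L := Subgroup.closure ((M : Set G) ∪ {x})
      have hML : M ≤ L := fun a ha => Subgroup.subset_closure (Or.inl ha)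
      have hxL : x ∈ L := Subgroup.subset_closure (Or.inr rfl)
      have hLcomm : ∀ a ∈ L, ∀ b ∈ L, a * b = b * a := fun a ha b hb => by
        have := Subgroup.isMulCommutative_closure hgen
        exact congrArg Subtype.val (this.is_comm.comm (⟨a, ha⟩ : L) ⟨b, hb⟩)
      have hLnormal : L.Normal := ⟨fun a ha g => by
        induction ha using Subgroup.closure_induction with
        | mem a ha =>
          rcases ha with ha | rfl
          · exact hML (hnormal.conj_mem a ha g)
          · have : g * a * g⁻¹ = (⁅a, g⁆)⁻¹ * a := by
              rw [commutatorElement_def]; group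
            rw [this]
            exact mul_mem (inv_mem (hML (hcomm g))) hxL
        | one => simp
        | mul a b _ _ ha hb => rw [← conj_mul]; exact mul_mem ha hb
        | inv a _ ha => rw [← conj_inv]; exact inv_mem ha⟩
      exact hM.le_of_ge ⟨hLnormal, hLcomm⟩ hML hxL
  obtain ⟨n, hn⟩ := Group.IsNilpotent.nilpotent G
  exact fun x hx => key n x (hn ▸ Subgroup.mem_top x) hx

theorem HasTameAbelianSubgroups.isVirtuallyAbelian_of_isNilpotent
    (hG : HasTameAbelianSubgroups G) [Group.IsNilpotent G] : IsVirtuallyAbelian G := by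
  obtain ⟨M, hM⟩ := exists_maximal_normal_abelian G
  have hnormal : M.Normal := hM.prop.1
  have := hG.finiteIndex_centralizer hM.prop.2
  exact ⟨M, Subgroup.finiteIndex_of_le (centralizer_le_of_maximal hM),
    fun a b => Subtype.ext (hM.prop.2 a a.2 b b.2)⟩

theorem finiteIndex_of_pow_mem {C : Type*} [CommGroup C] [Group.FG C] {A : Subgroup C} {m : ℕ}
    (hm : 0 < m) (hA : ∀ c : C, c ^ m ∈ A) : A.FiniteIndex := by
  have htors : IsMulTorsion (C ⧸ A) := fun x => by
    induction x using QuotientGroup.induction_on with | H c => ?_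
    refine isOfFinOrder_iff_pow_eq_one.2 ⟨m, hm, ?_⟩
    rw [← QuotientGroup.mk_pow, QuotientGroup.eq_one_iff]
    exact hA c
  have := CommGroup.finite_of_fg_isMulTorsion (C ⧸ A) htors
  exact Subgroup.finiteIndex_of_finite_quotient

/-- A normal subgroup with an abelian subgroup of finite index has one that is normal in the
whole group. -/
theorem HasTameAbelianSubgroups.exists_normal_abelian (hG : HasTameAbelianSubgroups G)
    {N : Subgroup G} [hN : N.Normal] (h : IsVirtuallyAbelian N) :
    ∃ A : Subgroup G, A.Normal ∧ (∀ a ∈ A, ∀ b ∈ A, a * b = b * a) ∧ A.relIndex N ≠ 0 := by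
  obtain ⟨K, hK, hcomm⟩ := h
  set B := K.map N.subtype
  have hBcomm : ∀ a ∈ B, ∀ b ∈ B, a * b = b * a := by
    rintro _ ⟨a, ha, rfl⟩ _ ⟨b, hb, rfl⟩
    exact congrArg (fun x : K => ((x : N) : G)) (hcomm ⟨a, ha⟩ ⟨b, hb⟩)
  set m := K.index.factorial
  have hpow : ∀ x ∈ N, x ^ m ∈ B := fun x hx => ⟨⟨x, hx⟩ ^ m,
    Subgroup.pow_mem_of_index_ne_zero_of_dvd hK.index_ne_zero _
      (fun k hk hle => Nat.dvd_factorial hk hle), rfl⟩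
  set A := Subgroup.normalClosure ((fun x : G => x ^ m) '' N)
  have hAB : A ≤ B := by
    refine (Subgroup.closure_le _).2 fun y hy => ?_
    obtain ⟨_, ⟨x, hx, rfl⟩, hxy⟩ := Group.mem_conjugatesOfSet_iff.1 hy
    obtain ⟨c, rfl⟩ := isConj_iff.1 hxy
    simp only [← conj_pow]
    exact hpow _ (hN.conj_mem x hx c)
  refine ⟨A, inferInstance, fun a ha b hb => hBcomm a (hAB ha) b (hAB hb),
    Subgroup.relIndex_ne_zero_trans (K := B) ?_ ?_⟩
  · let : CommGroup B :=
      { (inferInstance : Group B) with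
        mul_comm := fun a b => Subtype.ext (hBcomm a a.2 b b.2) }
    have : Group.FG B := (Group.fg_iff_subgroup_fg B).2 (hG B hBcomm).1
    have : (A.subgroupOf B).FiniteIndex := finiteIndex_of_pow_mem (m := m) (Nat.factorial_pos _)
      fun c => Subgroup.subset_normalClosure
        ⟨c, (Subgroup.map_subtype_le K) c.2, rfl⟩
    exact this.index_ne_zero
  · rw [Subgroup.relIndex, Subgroup.subgroupOf, Subgroup.comap_map_eq_self_of_injective
      N.subtype_injective]
    exact hK.index_ne_zero

/-- A subgroup that centralizes both `A` and `N` modulo `A`, where `N` contains the derived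
subgroup, is nilpotent. -/
theorem isNilpotent_of_centralizes {A N H : Subgroup G} [A.Normal] (hN : commutator G ≤ N)
    (hA : H ≤ Subgroup.centralizer (A : Set G))
    (hNA : ∀ h ∈ H, ∀ x ∈ N, ⁅x, h⁆ ∈ A) : Group.IsNilpotent H := by
  have h1 : ∀ z : H, (z : G) ∈ A → z ∈ Subgroup.upperCentralSeries H 1 := fun z hz => by
    refine Subgroup.mem_upperCentralSeries_succ_iff.2 fun y => ?_
    rw [Subgroup.upperCentralSeries_zero, Subgroup.mem_bot, commutatorElement_eq_one_iff_mul_comm]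
    exact Subtype.ext (Subgroup.mem_centralizer_iff.1 (hA y.2) z hz)
  have h2 : ∀ z : H, (z : G) ∈ N → z ∈ Subgroup.upperCentralSeries H 2 := fun z hz =>
    Subgroup.mem_upperCentralSeries_succ_iff.2 fun y => h1 _ (hNA y y.2 z hz)
  refine ⟨3, eq_top_iff.2 fun z _ => Subgroup.mem_upperCentralSeries_succ_iff.2 fun y =>
    h2 _ (hN ?_)⟩
  exact Subgroup.commutator_mem_commutator (Subgroup.mem_top (z : G)) (Subgroup.mem_top (y : G))

theorem HasTameAbelianSubgroups.isVirtuallyAbelian_of_commutator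
    (hG : HasTameAbelianSubgroups G) (h : IsVirtuallyAbelian (commutator G)) :
    IsVirtuallyAbelian G := by
  obtain ⟨A, hnormal, hA, hindex⟩ := hG.exists_normal_abelian h
  have hC := hG.finiteIndex_centralizer hA
  set N := (commutator G).map (QuotientGroup.mk' A)
  have hN : (N : Set (G ⧸ A)).Finite := by
    have : Nat.card N ≠ 0 := by
      rw [← Subgroup.relIndex_ker, QuotientGroup.ker_mk']
      exact hindex
    exact Set.finite_coe_iff.1 (Nat.finite_of_card_ne_zero this)
  have hNnormal : N.Normal :=
    Subgroup.Normal.map inferInstance _ (QuotientGroup.mk'_surjective A)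
  have hD : (Subgroup.centralizer (N : Set (G ⧸ A))).FiniteIndex :=
    _root_.finiteIndex_centralizer hN fun g hg => hN.subset fun b hb => by
      obtain ⟨c, rfl⟩ := isConj_iff.1 hb
      exact hNnormal.conj_mem g hg c
  have hD' : ((Subgroup.centralizer (N : Set (G ⧸ A))).comap (QuotientGroup.mk' A)).FiniteIndex :=
    ⟨by
      rw [Subgroup.index_comap_of_surjective _ (QuotientGroup.mk'_surjective A)]
      exact hD.index_ne_zero⟩
  set H := Subgroup.centralizer (A : Set G) ⊓
    (Subgroup.centralizer (N : Set (G ⧸ A))).comap (QuotientGroup.mk' A)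
  have : Group.IsNilpotent H := isNilpotent_of_centralizes le_rfl inf_le_left fun h hh x hx => by
    rw [← QuotientGroup.eq_one_iff]
    exact commutatorElement_eq_one_iff_mul_comm.2
      (Subgroup.mem_centralizer_iff.1 hh.2 _ ⟨x, hx, rfl⟩)
  exact IsVirtuallyAbelian.of_subgroup (hG.subgroup H).isVirtuallyAbelian_of_isNilpotent

theorem HasTameAbelianSubgroups.isVirtuallyAbelian_of_derivedSeries_eq_bot (n : ℕ) :
    ∀ {G : Type*} [Group G], HasTameAbelianSubgroups G → derivedSeries G n = ⊥ →
      IsVirtuallyAbelian G := by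
  induction n with
  | zero =>
    intro G _ _ h
    rw [derivedSeries_zero] at h
    refine ⟨⊤, inferInstance, fun a b => Subtype.ext ?_⟩
    have htriv : ∀ x : G, x = 1 := fun x => Subgroup.mem_bot.1 (h ▸ Subgroup.mem_top x)
    exact (htriv _).trans (htriv _).symm
  | succ n ih =>
    intro G _ hG h
    refine hG.isVirtuallyAbelian_of_commutator (ih (hG.subgroup _) ?_)
    have hle : ∀ k, (derivedSeries (commutator G) k).map (commutator G).subtype ≤
        derivedSeries G (k + 1) := by
      intro k
      induction k with
      | zero => exact (Subgroup.map_subtype_le _).trans (derivedSeries_one G).ge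
      | succ k ihk =>
        rw [derivedSeries_succ, Subgroup.map_commutator, derivedSeries_succ G (k + 1)]
        exact Subgroup.commutator_mono ihk ihk
    rw [eq_bot_iff]
    intro x hx
    have := hle n ⟨x, hx, rfl⟩
    rw [h, Subgroup.mem_bot] at this
    exact Subgroup.mem_bot.2 (Subtype.ext this)

/-- A soluble group with tame abelian subgroups is virtually abelian. -/
theorem HasTameAbelianSubgroups.isVirtuallyAbelian (hG : HasTameAbelianSubgroups G)
    [Group.IsSolvable G] : IsVirtuallyAbelian G := by
  obtain ⟨n, hn⟩ := Group.IsSolvable.solvable (G := G)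
  exact isVirtuallyAbelian_of_derivedSeries_eq_bot n hG hn

end SolubleGroups

section Graphs

namespace SimpleGraph

variable {V : Type*} {Γ : SimpleGraph V}

/-- The graph metric of a connected graph. -/
noncomputable abbrev Connected.metricSpace (h : Γ.Connected) : MetricSpace V where
  dist u v := Γ.dist u v
  dist_self u := by simp
  dist_comm u v := congrArg Nat.cast dist_comm
  dist_triangle u v w := by exact_mod_cast h.dist_triangle
  eq_of_dist_eq_zero huv := h.dist_eq_zero_iff.1 (by exact_mod_cast huv)

theorem Connected.dist_map_le {V' : Type*} {Γ' : SimpleGraph V'} (h : Γ.Connected)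
    (f : Γ →g Γ') (u v : V) : Γ'.dist (f u) (f v) ≤ Γ.dist u v := by
  obtain ⟨p, hp⟩ := h.exists_walk_length_eq_dist u v
  exact hp ▸ (p.length_map f) ▸ dist_le (p.map f)

theorem Connected.dist_smul {G : Type*} [Group G] [MulAction G V] (h : Γ.Connected)
    (hauto : ∀ (g : G) (u v : V), Γ.Adj (g • u) (g • v) ↔ Γ.Adj u v) (g : G) (u v : V) :
    Γ.dist (g • u) (g • v) = Γ.dist u v := by
  have hle (k : G) (x y : V) : Γ.dist (k • x) (k • y) ≤ Γ.dist x y :=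
    h.dist_map_le ⟨fun z => k • z, fun {a b} hab => (hauto k a b).2 hab⟩ x y
  refine (hle g u v).antisymm ?_
  simpa using hle g⁻¹ (g • u) (g • v)

theorem Connected.exists_dist_le_dist_le (h : Γ.Connected) {u v : V} {m n : ℕ}
    (huv : Γ.dist u v ≤ m + n) : ∃ w, Γ.dist u w ≤ m ∧ Γ.dist v w ≤ n := by
  obtain ⟨p, hp⟩ := h.exists_walk_length_eq_dist u v
  refine ⟨p.getVert m, (dist_le (p.take m)).trans ?_, ?_⟩
  · rw [Walk.take_length]
    exact min_le_left _ _
  · rw [dist_comm]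
    refine (dist_le (p.drop m)).trans ?_
    rw [Walk.drop_length]
    omega

theorem Connected.finite_setOf_dist_le (h : Γ.Connected)
    (hlf : ∀ v : V, (Γ.neighborSet v).Finite) (v : V) (n : ℕ) : {u | Γ.dist v u ≤ n}.Finite := by
  induction n with
  | zero =>
    refine (Set.finite_singleton v).subset fun u hu => ?_
    exact (h.dist_eq_zero_iff.1 (Nat.le_zero.1 hu)).symm
  | succ n ih =>
    refine (ih.union (ih.biUnion fun w _ => hlf w)).subset fun u hu => ?_
    obtain ⟨w, hw, huw⟩ := h.exists_dist_le_dist_le (m := n) (n := 1) hu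
    rcases Nat.le_one_iff_eq_zero_or_eq_one.1 huw with huw | huw
    · exact Or.inl ((h.dist_eq_zero_iff.1 huw) ▸ hw)
    · exact Or.inr (Set.mem_biUnion hw (dist_eq_one_iff_adj.1 huw).symm)

theorem Connected.countable (h : Γ.Connected) (hlf : ∀ v : V, (Γ.neighborSet v).Finite) :
    Countable V := by
  obtain ⟨v⟩ := h.nonempty
  have huniv : (⋃ n : ℕ, {u | Γ.dist v u ≤ n}) = Set.univ :=
    Set.eq_univ_of_forall fun u => Set.mem_iUnion.2 ⟨Γ.dist v u, le_refl (Γ.dist v u)⟩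
  rw [← Set.countable_univ_iff, ← huniv]
  exact Set.countable_iUnion fun n => (h.finite_setOf_dist_le hlf v n).countable

/-- Every family of pairwise intersecting balls, indexed in a fixed universe, has a common point. -/
def IsHelly.{u} (Γ : SimpleGraph V) : Prop :=
  ∀ {ι : Type u} (c : ι → V) (r : ι → ℕ),
    (∀ i j : ι, ({u : V | Γ.dist (c i) u ≤ r i} ∩ {u : V | Γ.dist (c j) u ≤ r j}).Nonempty) →
    (⋂ i : ι, {u : V | Γ.dist (c i) u ≤ r i}).Nonempty

theorem IsHelly.isCoarselyInjective (hHelly : Γ.IsHelly) (h : Γ.Connected)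
    (hlf : ∀ v : V, (Γ.neighborSet v).Finite) :
    @IsCoarselyInjective V h.metricSpace.toPseudoMetricSpace := by
  let : MetricSpace V := h.metricSpace
  have := h.countable hlf
  have := h.nonempty
  obtain ⟨e, he⟩ := exists_surjective_nat V
  intro f hf
  obtain ⟨w, hw⟩ := hHelly (fun i : ULift ℕ => e i.down) (fun i => ⌈f (e i.down)⌉₊)
    fun i j => h.exists_dist_le_dist_le (by
      have hle : (Γ.dist (e i.down) (e j.down) : ℝ) ≤ _ := hf (e i.down) (e j.down)
      have := hle.trans (add_le_add (Nat.le_ceil _) (Nat.le_ceil _))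
      exact_mod_cast this)
  refine ⟨w, fun x => ?_⟩
  obtain ⟨n, rfl⟩ := he x
  have hn : Γ.dist (e n) w ≤ ⌈f (e n)⌉₊ := Set.mem_iInter.1 hw ⟨n⟩
  have hn : Dist.dist (e n) w ≤ ⌈f (e n)⌉₊ := Nat.cast_le.2 hn
  rw [_root_.dist_comm]
  exact hn.trans (Nat.ceil_lt_add_one (hf.nonneg _)).le

end SimpleGraph

variable {G X : Type*} [Group G] [MulAction G X]

theorem exists_forall_le_of_finite_orbitRel [Finite (MulAction.orbitRel.Quotient G X)]
    {c : X → ℕ → Prop} (hc : ∀ x, ∃ N, c x N) (hmono : ∀ x m n, m ≤ n → c x m → c x n)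
    (hsmul : ∀ (g : G) x n, c x n → c (g • x) n) : ∃ N, ∀ x, c x N := by
  choose N hN using hc
  have := Fintype.ofFinite (MulAction.orbitRel.Quotient G X)
  refine ⟨Finset.univ.sup fun q : MulAction.orbitRel.Quotient G X => N q.out, fun x => ?_⟩
  have hx : x ∈ MulAction.orbit G (Quotient.mk (MulAction.orbitRel G X) x).out :=
    (MulAction.orbitRel G X).symm' (Quotient.mk_out (s := MulAction.orbitRel G X) x)
  obtain ⟨g, hg⟩ := hx
  rw [← hg]
  exact hsmul g _ _ (hmono _ _ _ (Finset.le_sup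
    (f := fun q : MulAction.orbitRel.Quotient G X => N q.out) (Finset.mem_univ _)) (hN _))

variable [PseudoMetricSpace X]

theorem IsUniformlyProperAction.subgroup (hG : IsUniformlyProperAction G X) (A : Subgroup G) :
    IsUniformlyProperAction A X := by
  intro r
  obtain ⟨N, hN⟩ := hG r
  refine ⟨N, fun x T hT => ?_⟩
  rw [← Finset.card_map ⟨A.subtype, A.subtype_injective⟩]
  refine hN x _ fun g hg => ?_
  obtain ⟨a, ha, rfl⟩ := Finset.mem_map.1 hg
  exact hT a ha

variable [IsIsometricSMul G X]

theorem hasBoundedGeometry_of_finite_orbitRel [Finite (MulAction.orbitRel.Quotient G X)]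
    (hX : ∀ (x : X) (r : ℝ), {y | dist x y ≤ r}.Finite) : HasBoundedGeometry X := by
  classical
  intro r
  refine exists_forall_le_of_finite_orbitRel (G := G)
    (fun x => ⟨(hX x r).toFinset.card, fun T hT =>
      Finset.card_le_card fun y hy => (hX x r).mem_toFinset.2 (hT y hy)⟩)
    (fun x m n hmn h T hT => (h T hT).trans hmn) fun g x n h T hT => ?_
  rw [← Finset.card_image_of_injective T (MulAction.injective g⁻¹)]
  refine h _ fun y hy => ?_
  obtain ⟨z, hz, rfl⟩ := Finset.mem_image.1 hy
  rw [← dist_smul g, smul_inv_smul]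
  exact hT z hz

theorem isUniformlyProperAction_of_finite_orbitRel [Finite (MulAction.orbitRel.Quotient G X)]
    (hG : ∀ (x : X) (r : ℝ), {g : G | dist x (g • x) ≤ r}.Finite) :
    IsUniformlyProperAction G X := by
  classical
  intro r
  refine exists_forall_le_of_finite_orbitRel (G := G)
    (fun x => ⟨(hG x r).toFinset.card, fun T hT =>
      Finset.card_le_card fun y hy => (hG x r).mem_toFinset.2 (hT y hy)⟩)
    (fun x m n hmn h T hT => (h T hT).trans hmn) fun g x n h T hT => ?_
  rw [← Finset.card_image_of_injective T (MulAut.conj g⁻¹).injective]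
  refine h _ fun y hy => ?_
  obtain ⟨z, hz, rfl⟩ := Finset.mem_image.1 hy
  rw [← dist_smul g, MulAut.conj_apply, inv_inv, mul_smul, mul_smul, smul_inv_smul]
  exact hT z hz

theorem HasTameAbelianSubgroups.of_isUniformlyProperAction [Nonempty X]
    (hX : IsCoarselyInjective X) (hG : IsUniformlyProperAction G X)
    (hb : HasBoundedGeometry X) : HasTameAbelianSubgroups G := by
  intro A hA
  obtain ⟨x₀⟩ := ‹Nonempty X›
  let : CommGroup A :=
    { (inferInstance : Group A) with mul_comm := fun a b => Subtype.ext (hA a a.2 b b.2) }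
  have : IsIsometricSMul A X := ⟨fun a => isometry_smul X (a : G)⟩
  have hAX : IsUniformlyProperAction A X := hG.subgroup A
  refine ⟨(Group.fg_iff_subgroup_fg A).1 (CommGroup.fg_of_isUniformlyProperAction hX hAX hb x₀),
    fun a _ => ?_⟩
  refine ((finite_translationLength_le hX hAX x₀ (dist x₀ (a • x₀))).image
    A.subtype).subset fun b hb' => ?_
  obtain ⟨hbA, hab⟩ := hb'
  obtain ⟨g, rfl⟩ := isConj_iff.1 hab
  exact ⟨⟨_, hbA⟩, translationLength_conj_le x₀ a g, rfl⟩

end Graphs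

/-- Soluble subgroups of Helly groups are virtually abelian.

Here a Helly group is a group `G` acting geometrically (properly and cocompactly, by
graph automorphisms) on a Helly graph: a connected, locally finite simple graph `Γ` such
that every family of pairwise intersecting balls has nonempty total intersection. -/
theorem soluble_subgroups_of_helly_groups_are_virtually_abelian
    {G : Type*} [Group G] {V : Type*} (Γ : SimpleGraph V)
    (hconn : Γ.Connected)
    (hlf : ∀ v : V, (Γ.neighborSet v).Finite)
    (hHelly : ∀ {ι : Type*} (c : ι → V) (r : ι → ℕ),
      (∀ i j : ι,
        ({u : V | Γ.dist (c i) u ≤ r i} ∩ {u : V | Γ.dist (c j) u ≤ r j}).Nonempty) →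
      (⋂ i : ι, {u : V | Γ.dist (c i) u ≤ r i}).Nonempty)
    [MulAction G V]
    (hauto : ∀ (g : G) (u v : V), Γ.Adj (g • u) (g • v) ↔ Γ.Adj u v)
    (hproper : ∀ (v : V) (r : ℕ), {g : G | Γ.dist v (g • v) ≤ r}.Finite)
    (hcocompact : Finite (MulAction.orbitRel.Quotient G V)) :
    ∀ H : Subgroup G, IsSolvable H →
      ∃ K : Subgroup H, K.FiniteIndex ∧ ∀ a b : K, a * b = b * a := by
  intro H hH
  have : Group.IsSolvable H := hH
  have hX := SimpleGraph.IsHelly.isCoarselyInjective hHelly hconn hlf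
  let : MetricSpace V := hconn.metricSpace
  have := hconn.nonempty
  have : IsIsometricSMul G V := ⟨fun g => Isometry.of_dist_eq fun u v =>
    congrArg Nat.cast (hconn.dist_smul hauto g u v)⟩
  have hb : HasBoundedGeometry V := hasBoundedGeometry_of_finite_orbitRel (G := G) fun v r =>
    (hconn.finite_setOf_dist_le hlf v ⌊r⌋₊).subset fun _ hu => Nat.le_floor hu
  have hG : IsUniformlyProperAction G V := isUniformlyProperAction_of_finite_orbitRel fun v r =>
    (hproper v ⌊r⌋₊).subset fun _ hg => Nat.le_floor hg
  have htame := HasTameAbelianSubgroups.of_isUniformlyProperAction hX hG hb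
  exact (htame.subgroup H).isVirtuallyAbelian
end
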